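/- arXiv:2008.00935 — 4 statements merged into one kernel-verified Lean document; each statement's English description precedes it below -/
import Mathlib

section
/- Let n ≥ 2, let 𝒫₁ and 𝒫₂ be generalized n-dimensional polytopes in ℝⁿ, and let S = {σ(t) : t ∈ D} be a rationally parameterisable hypersurface in ℝⁿ. Suppose O is a nonempty open subset of D ∖ σ₁⁻¹(0) in ℝ^{n−1} that satisfies the hyperplane condition and the inner point condition. If F_{𝒫₁}(σ(t)) = F_{𝒫₂}(σ(t)) for every t ∈ O, then 𝒫₁ = 𝒫₂. -/
open scoped RealInnerProductSpace

/-- The Fourier transform of (the characteristic function of) a set `P ⊆ ℝⁿ`: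
`F_P(s) = ∫_P exp(-i s·x) dx`. -/
noncomputable def fourierTransformSet {n : ℕ} (P : Set (EuclideanSpace ℝ (Fin n)))
    (s : EuclideanSpace ℝ (Fin n)) : ℂ :=
  ∫ x in P, Complex.exp (-Complex.I * ((⟪s, x⟫ : ℝ) : ℂ))

/-- A convex `n`-dimensional polytope in `ℝⁿ`: the convex hull of a finite set of points,
with nonempty interior. -/
def IsConvexPolytope {n : ℕ} (P : Set (EuclideanSpace ℝ (Fin n))) : Prop :=
  ∃ V : Finset (EuclideanSpace ℝ (Fin n)),
    P = convexHull ℝ (V : Set (EuclideanSpace ℝ (Fin n))) ∧ (interior P).Nonempty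

/-- A generalized `n`-dimensional polytope in `ℝⁿ`: a union of finitely many (at least one)
convex `n`-dimensional polytopes. -/
def IsGenPolytope {n : ℕ} (P : Set (EuclideanSpace ℝ (Fin n))) : Prop :=
  ∃ (m : ℕ) (Q : Fin (m + 1) → Set (EuclideanSpace ℝ (Fin n))),
    (∀ i, IsConvexPolytope (Q i)) ∧ P = ⋃ i, Q i

open Polynomial in
lemma ws_coprime {p q a B : Polynomial ℂ} (hp : p ≠ 0) (hq : q ≠ 0) (hB : B ≠ 0)
    (hab : IsCoprime a B)
    (h : B ^ 2 * wronskian p q = p * q * wronskian a B) : wronskian a B = 0 := by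
  by_contra hw
  by_cases hdeg : B.natDegree = 0
  · obtain ⟨c, rfl⟩ := natDegree_eq_zero.mp hdeg
    have hw2 : wronskian p q ≠ 0 := by
      intro h0
      rw [h0, mul_zero] at h
      exact mul_ne_zero (mul_ne_zero hp hq) hw h.symm
    have h1 := natDegree_wronskian_lt_add hw2
    have h2 : (C c ^ 2 * wronskian p q).natDegree = (wronskian p q).natDegree := by
      rw [natDegree_mul (pow_ne_zero _ hB) hw2]; simp
    have h3 : (p * q * wronskian a (C c)).natDegree = p.natDegree + q.natDegree + (wronskian a (C c)).natDegree := by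
      rw [natDegree_mul (mul_ne_zero hp hq) hw, natDegree_mul hp hq]
    rw [h] at h2
    omega
  · have hd : B.degree ≠ 0 := fun hh => hdeg (natDegree_eq_of_degree_eq_some hh)
    obtain ⟨z, hz⟩ := Complex.exists_root (f := B) (by
      rw [← natDegree_pos_iff_degree_pos]; omega)
    obtain ⟨b, hb, hbz⟩ := exists_eq_pow_rootMultiplicity_mul_and_not_dvd B hB z
    obtain ⟨p1, hp1, hpz⟩ := exists_eq_pow_rootMultiplicity_mul_and_not_dvd p hp z
    obtain ⟨q1, hq1, hqz⟩ := exists_eq_pow_rootMultiplicity_mul_and_not_dvd q hq z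
    have he : 0 < rootMultiplicity z B := (rootMultiplicity_pos hB).2 hz
    generalize rootMultiplicity z B = e at *
    generalize rootMultiplicity z p = i at *
    generalize rootMultiplicity z q = j at *
    rw [dvd_iff_isRoot, IsRoot] at hbz hpz hqz
    have haz : a.eval z ≠ 0 := by
      obtain ⟨u, v, huv⟩ := hab
      intro h0
      have := congrArg (eval z) huv
      rw [IsRoot] at hz
      simp [h0, hz] at this
    have key : ∀ k : ℕ, (X - C z) * derivative ((X - C z) ^ k) = C (k : ℂ) * (X - C z) ^ k := by
      intro k
      rcases k with _ | k
      · simp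
      · rw [derivative_X_sub_C_pow, Nat.add_sub_cancel, pow_succ]; ring
    set Y := X - C z with hY
    have hYne : Y ≠ 0 := X_sub_C_ne_zero z
    have e1 : Y * wronskian p q = Y ^ (i + j) * (C ((j : ℂ) - i) * p1 * q1 + Y * wronskian p1 q1) := by
      have h1 := key i
      have h2 := key j
      simp only [wronskian, hp1, hq1, derivative_mul, map_sub]
      linear_combination (Y^i*p1 * q1) * h2 - (Y^j *p1 * q1) * h1
    have e2 : Y * wronskian a B = Y ^ e * (Y * wronskian a b + C (e : ℂ) * a * b) := by
      have h1 := key e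
      simp only [wronskian, hb, derivative_mul]
      linear_combination (a * b) * h1
    have e3 : Y ^ (i + j + e) * (Y ^ e * b ^ 2 * (C ((j : ℂ) - i) * p1 * q1 + Y * wronskian p1 q1)) =
        Y ^ (i + j + e) * (p1 * q1 * (Y * wronskian a b + C (e : ℂ) * a * b)) := by
      have h4 : B ^ 2 * (Y * wronskian p q) = p * q * (Y * wronskian a B) := by
        linear_combination Y * h
      rw [e1, e2, hb, hp1, hq1] at h4
      linear_combination h4
    have e4 := congrArg (eval z) (mul_left_cancel₀ (pow_ne_zero _ hYne) e3)
    simp [hY, he.ne', hbz, hpz, hqz, haz] at e4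

open Polynomial in
lemma ws_main {p q a B : Polynomial ℂ} (hp : p ≠ 0) (hq : q ≠ 0) (hB : B ≠ 0)
    (h : B ^ 2 * wronskian p q = p * q * wronskian a B) : ∃ c : ℂ, a = C c * B := by
  obtain ⟨d, a1, B1, hd, ha, hb⟩ : ∃ d a1 B1 : ℂ[X], IsCoprime a1 B1 ∧ a = d * a1 ∧ B = d * B1 := by
    exact ⟨GCDMonoid.gcd a B, a / GCDMonoid.gcd a B, B / GCDMonoid.gcd a B,
      isCoprime_div_gcd_div_gcd hB,
      (EuclideanDomain.mul_div_cancel' (gcd_ne_zero_of_right hB) (gcd_dvd_left _ _)).symm,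
      (EuclideanDomain.mul_div_cancel' (gcd_ne_zero_of_right hB) (gcd_dvd_right _ _)).symm⟩
  have hd0 : d ≠ 0 := by rintro rfl; simp at hb; exact hB hb
  have hB1 : B1 ≠ 0 := by rintro rfl; simp at hb; exact hB hb
  have e1 : d ^ 2 * (B1 ^ 2 * wronskian p q) = d ^ 2 * (p * q * wronskian a1 B1) := by
    have : wronskian a B = d ^ 2 * wronskian a1 B1 := by
      simp only [wronskian, ha, hb, derivative_mul]; ring
    rw [this, hb] at h
    linear_combination h
  have e2 := ws_coprime hp hq hB1 hd (mul_left_cancel₀ (pow_ne_zero _ hd0) e1)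
  obtain ⟨h1, h2⟩ := hd.wronskian_eq_zero_iff.mp e2
  obtain ⟨x, hx⟩ := natDegree_eq_zero.mp (derivative_eq_zero.mp h1)
  obtain ⟨y, hy⟩ := natDegree_eq_zero.mp (derivative_eq_zero.mp h2)
  have hy0 : y ≠ 0 := by rintro rfl; simp at hy; exact hB1 hy.symm
  refine ⟨x / y, ?_⟩
  rw [ha, hb, ← hx, ← hy]
  have : (C x : ℂ[X]) = C (x / y) * C y := by rw [← C_mul, div_mul_cancel₀ _ hy0]
  rw [this]; ring

open Polynomial in
lemma poly_zero_of_interval {p : Polynomial ℂ} {ε : ℝ} (hε : 0 < ε)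
    (h : ∀ x : ℝ, |x| < ε → p.eval (x : ℂ) = 0) : p = 0 := by
  apply eq_zero_of_infinite_isRoot
  have : (Set.Ioo (0:ℝ) ε).Infinite := Set.Ioo_infinite hε
  refine (this.image (f := fun x : ℝ => (x : ℂ)) Complex.ofReal_injective.injOn).mono ?_
  rintro _ ⟨x, hx, rfl⟩
  exact h x (by rw [abs_of_pos hx.1]; exact hx.2)

open Polynomial in
lemma exp_indep_uni {κ : Type} [DecidableEq κ] (N : κ → Polynomial ℂ) (B : Polynomial ℂ)
    {ε : ℝ} (hε : 0 < ε) (hB : ∀ x : ℝ, |x| < ε → B.eval (x : ℂ) ≠ 0) (S : Finset κ) :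
    (∀ v ∈ S, ∀ w ∈ S, v ≠ w → ¬ ∃ c, N v - N w = C c * B) →
    ∀ P : κ → Polynomial ℂ,
    (∀ x : ℝ, |x| < ε → ∑ v ∈ S, (P v).eval (x : ℂ) *
      Complex.exp ((N v).eval (x : ℂ) / B.eval (x : ℂ)) = 0) →
    ∀ v ∈ S, P v = 0 := by
  have hB0 : B ≠ 0 := by
    rintro rfl
    exact hB 0 (by simpa using hε) (by simp)
  induction S using Finset.induction_on with
  | empty => simp
  | insert u S hu ih =>
    intro hS P hP
    have ih' := ih (fun v hv w hw => hS v (Finset.mem_insert_of_mem hv) w (Finset.mem_insert_of_mem hw))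
    by_cases hPu : P u = 0
    · intro v hv
      rcases Finset.mem_insert.mp hv with rfl | hv
      · exact hPu
      · refine ih' P ?_ v hv
        intro x hx
        have := hP x hx
        rwa [Finset.sum_insert hu, hPu, eval_zero, zero_mul, zero_add] at this
    · exfalso
      let w : κ → Polynomial ℂ := fun v => derivative (N v) * B - N v * derivative B
      -- derivative relation
      have hder : ∀ x : ℝ, |x| < ε → ∑ v ∈ insert u S,
          (B ^ 2 * derivative (P v) + P v * w v).eval (x : ℂ) *
          Complex.exp ((N v).eval (x : ℂ) / B.eval (x : ℂ)) = 0 := by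
        intro x hx
        have hd : ∀ v, HasDerivAt (fun y : ℝ => (P v).eval (y : ℂ) *
            Complex.exp ((N v).eval (y : ℂ) / B.eval (y : ℂ)))
            ((derivative (P v)).eval (x : ℂ) * Complex.exp ((N v).eval (x : ℂ) / B.eval (x : ℂ))
             + (P v).eval (x : ℂ) * (Complex.exp ((N v).eval (x : ℂ) / B.eval (x : ℂ)) *
              (((derivative (N v)).eval (x : ℂ) * B.eval (x : ℂ) - (N v).eval (x : ℂ) * (derivative B).eval (x : ℂ)) / B.eval (x : ℂ) ^ 2))) x := by
          intro v
          have h1 := ((P v).hasDerivAt (x : ℂ)).comp_ofReal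
          have h2 := (((N v).hasDerivAt (x : ℂ)).div (B.hasDerivAt (x : ℂ)) (hB x hx)).cexp.comp_ofReal
          exact h1.mul h2
        have hsum := HasDerivAt.fun_sum (u := insert u S) (fun v _ => hd v)
        have hz : (fun y : ℝ => ∑ v ∈ insert u S, (P v).eval (y : ℂ) *
            Complex.exp ((N v).eval (y : ℂ) / B.eval (y : ℂ))) =ᶠ[nhds x] fun _ => 0 := by
          have : {y : ℝ | |y| < ε} ∈ nhds x := (isOpen_lt continuous_abs continuous_const).mem_nhds hx
          filter_upwards [this] with y hy using hP y hy
        have h0 := (hsum.congr_of_eventuallyEq hz.symm).unique (hasDerivAt_const x (0:ℂ))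
        have h1 := congrArg (fun z => B.eval (x : ℂ) ^ 2 * z) h0
        simp only [mul_zero, Finset.mul_sum] at h1
        rw [← h1]
        refine Finset.sum_congr rfl fun v _ => ?_
        have hBx := hB x hx
        simp only [w, eval_add, eval_mul, eval_sub, eval_pow]
        field_simp
      have hq := ih' (fun v => P u * (B ^ 2 * derivative (P v) + P v * w v)
          - P v * (B ^ 2 * derivative (P u) + P u * w u)) (by
        intro x hx
        have h1 := hP x hx
        have h2 := hder x hx
        rw [Finset.sum_insert hu] at h1 h2
        have : ∑ v ∈ S, (P u * (B ^ 2 * derivative (P v) + P v * w v)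
          - P v * (B ^ 2 * derivative (P u) + P u * w u)).eval (x : ℂ) *
            Complex.exp ((N v).eval (x : ℂ) / B.eval (x : ℂ)) =
            (P u).eval (x:ℂ) * ∑ v ∈ S, (B ^ 2 * derivative (P v) + P v * w v).eval (x : ℂ) *
              Complex.exp ((N v).eval (x : ℂ) / B.eval (x : ℂ)) -
            (B ^ 2 * derivative (P u) + P u * w u).eval (x:ℂ) * ∑ v ∈ S, (P v).eval (x : ℂ) *
              Complex.exp ((N v).eval (x : ℂ) / B.eval (x : ℂ)) := by
          rw [Finset.mul_sum, Finset.mul_sum, ← Finset.sum_sub_distrib]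
          refine Finset.sum_congr rfl fun v _ => ?_
          simp only [eval_add, eval_mul, eval_sub, eval_pow]
          ring
        rw [this]
        linear_combination (P u).eval (x:ℂ) * h2 - (B ^ 2 * derivative (P u) + P u * w u).eval (x:ℂ) * h1)
      have hz : ∀ v ∈ S, P v = 0 := by
        intro v hv
        by_contra hPv
        have h1 := hq v hv
        refine hS v (Finset.mem_insert_of_mem hv) u (Finset.mem_insert_self _ _)
          (fun h => hu (h ▸ hv)) (ws_main hPu hPv hB0 ?_)
        simp only [wronskian, derivative_sub]
        simp only [w] at h1
        linear_combination h1
      apply hPu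
      refine poly_zero_of_interval hε fun x hx => ?_
      have h1 := hP x hx
      rw [Finset.sum_insert hu, Finset.sum_eq_zero (fun v hv => by rw [hz v hv]; simp), add_zero] at h1
      exact (mul_eq_zero.mp h1).resolve_right (Complex.exp_ne_zero _)

lemma exp_indep_multi {m : ℕ} {κ : Type} [DecidableEq κ] (S : Finset κ)
    (N P : κ → MvPolynomial (Fin m) ℂ) (B : MvPolynomial (Fin m) ℂ)
    (O : Set (Fin m → ℝ)) (hO : IsOpen O)
    (hB : ∀ t ∈ O, MvPolynomial.eval (fun i => (t i : ℂ)) B ≠ 0)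
    (hN : ∀ v ∈ S, ∀ w ∈ S, v ≠ w → ¬ ∃ c : ℂ, ∀ t ∈ O,
      MvPolynomial.eval (fun i => (t i : ℂ)) (N v - N w) = c * MvPolynomial.eval (fun i => (t i : ℂ)) B)
    (hP : ∀ t ∈ O, ∑ v ∈ S, MvPolynomial.eval (fun i => (t i : ℂ)) (P v) *
      Complex.exp (MvPolynomial.eval (fun i => (t i : ℂ)) (N v) /
        MvPolynomial.eval (fun i => (t i : ℂ)) B) = 0) :
    ∀ v ∈ S, ∀ t ∈ O, MvPolynomial.eval (fun i => (t i : ℂ)) (P v) = 0 := by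
  intro v₀ hv₀ t₀ ht₀
  have hb := hB t₀ ht₀
  let ev : (Fin m → ℝ) → MvPolynomial (Fin m) ℂ →+* ℂ := fun t => MvPolynomial.eval (fun i => (t i : ℂ))
  let Q : κ × κ → MvPolynomial (Fin m) ℂ := fun vw =>
    MvPolynomial.C (ev t₀ B) * (N vw.1 - N vw.2) - MvPolynomial.C (ev t₀ (N vw.1 - N vw.2)) * B
  have hQ : ∀ vw ∈ S.offDiag, Q vw ≠ 0 := by
    rintro ⟨v, w⟩ hvw h0
    obtain ⟨hv, hw, hne⟩ := Finset.mem_offDiag.mp hvw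
    refine hN v hv w hw hne ⟨ev t₀ (N v - N w) / ev t₀ B, fun t ht => ?_⟩
    have h1 := congrArg (ev t) h0
    simp only [Q, ev, map_sub, map_mul, MvPolynomial.eval_C, map_zero] at h1 ⊢
    field_simp
    linear_combination h1
  have hprod : ∏ vw ∈ S.offDiag, Q vw ≠ 0 := Finset.prod_ne_zero_iff.mpr hQ
  obtain ⟨t₁, ht₁⟩ : ∃ t₁ : Fin m → ℝ, ev t₁ (∏ vw ∈ S.offDiag, Q vw) ≠ 0 := by
    by_contra! hcon
    apply hprod
    refine MvPolynomial.funext_set (fun _ => Set.range (fun x : ℝ => (x : ℂ))) (fun _ => Set.infinite_range_of_injective Complex.ofReal_injective) ?_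
    intro x hx
    choose t ht using fun i => hx i (Set.mem_univ i)
    have : x = fun i => (t i : ℂ) := funext fun i => (ht i).symm
    rw [this, map_zero]
    exact hcon t
  rw [map_prod, Finset.prod_ne_zero_iff] at ht₁
  let φ : MvPolynomial (Fin m) ℂ →ₐ[ℂ] Polynomial ℂ :=
    MvPolynomial.aeval (fun i => Polynomial.C (t₀ i : ℂ) + Polynomial.X * Polynomial.C ((t₁ i : ℂ) - t₀ i))
  have hφ : ∀ (p : MvPolynomial (Fin m) ℂ) (x : ℝ), (φ p).eval (x : ℂ) =
      ev (fun i => t₀ i + x * (t₁ i - t₀ i)) p := by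
    intro p x
    simp only [φ, ev]
    induction p using MvPolynomial.induction_on with
    | C a => simp
    | add p q hp hq => simp only [map_add, Polynomial.eval_add, hp, hq]
    | mul_X p i hp => simp only [map_mul, Polynomial.eval_mul, hp]; simp
  have hline : ∃ ε > 0, ∀ x : ℝ, |x| < ε → (fun i => t₀ i + x * (t₁ i - t₀ i)) ∈ O := by
    have hc : Continuous (fun x : ℝ => (fun i => t₀ i + x * (t₁ i - t₀ i))) := by fun_prop
    have : (fun x : ℝ => (fun i => t₀ i + x * (t₁ i - t₀ i))) ⁻¹' O ∈ nhds (0:ℝ) := by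
      apply (hO.preimage hc).mem_nhds
      simpa using ht₀
    obtain ⟨ε, hε, h⟩ := Metric.mem_nhds_iff.mp this
    exact ⟨ε, hε, fun x hx => h (by simpa using hx)⟩
  obtain ⟨ε, hε, hline⟩ := hline
  have hmain := exp_indep_uni (fun v => φ (N v)) (φ B) hε
    (fun x hx => by rw [hφ]; exact hB _ (hline x hx)) S (by
      intro v hv w hw hne ⟨c, hc⟩
      apply ht₁ (v, w) (Finset.mem_offDiag.mpr ⟨hv, hw, hne⟩)
      have h0 := congrArg (Polynomial.eval ((0:ℝ):ℂ)) hc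
      have h1 := congrArg (Polynomial.eval ((1:ℝ):ℂ)) hc
      simp only [Polynomial.eval_sub, Polynomial.eval_mul, hφ, Polynomial.eval_C] at h0 h1
      simp only [zero_mul, add_zero, one_mul, add_sub_cancel] at h0 h1
      simp only [Q, ev, map_sub, map_mul, MvPolynomial.eval_C] at h0 h1 ⊢
      rw [h0, h1]; ring) (fun v => φ (P v)) (by
      intro x hx
      simp only [hφ]
      exact hP _ (hline x hx)) v₀ hv₀
  have h2 := hφ (P v₀) 0
  rw [hmain] at h2
  simpa [ev] using h2.symm

noncomputable def FTs {n : ℕ} (A : Set (Fin n → ℝ)) (s : Fin n → ℝ) : ℂ :=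
  ∫ x in A, Complex.exp (-Complex.I * ((s ⬝ᵥ x : ℝ) : ℂ))

def ExpRat (n : ℕ) (f : (Fin n → ℝ) → ℂ) : Prop :=
  ∃ (ι : Type) (_ : Fintype ι) (c : ι → ℂ) (v : ι → Fin n → ℝ) (L : ι → Fin n → Fin n → ℝ),
    (∀ a k, L a k ≠ 0) ∧ ∀ s, (∀ a k, L a k ⬝ᵥ s ≠ 0) →
      f s = ∑ a, c a * Complex.exp (-Complex.I * ((v a ⬝ᵥ s : ℝ) : ℂ)) /
        ∏ k, ((L a k ⬝ᵥ s : ℝ) : ℂ)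

lemma ExpRat.zero (n : ℕ) : ExpRat n (fun _ => 0) :=
  ⟨Empty, inferInstance, fun a => a.elim, fun a => a.elim, fun a => a.elim, fun a => a.elim, by simp⟩

lemma ExpRat.dimZero (f : (Fin 0 → ℝ) → ℂ) : ExpRat 0 f :=
  ⟨Unit, inferInstance, fun _ => f 0, fun _ => 0, fun _ => 0, fun _ k => k.elim0, fun s _ => by
    have : s = 0 := Subsingleton.elim _ _
    simp [this]⟩

lemma ExpRat.add {n : ℕ} {f g : (Fin n → ℝ) → ℂ} (hf : ExpRat n f) (hg : ExpRat n g) :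
    ExpRat n (fun s => f s + g s) := by
  obtain ⟨ι, _, c, v, L, hL, h⟩ := hf
  obtain ⟨ι', _, c', v', L', hL', h'⟩ := hg
  refine ⟨ι ⊕ ι', inferInstance, Sum.elim c c', Sum.elim v v', Sum.elim L L', ?_, ?_⟩
  · rintro (a | a) k
    · exact hL a k
    · exact hL' a k
  · intro s hs
    dsimp only
    rw [h s (fun a k => hs (Sum.inl a) k), h' s (fun a k => hs (Sum.inr a) k)]
    simp

lemma ExpRat.const_mul {n : ℕ} {f : (Fin n → ℝ) → ℂ} (hf : ExpRat n f) (z : ℂ) :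
    ExpRat n (fun s => z * f s) := by
  obtain ⟨ι, _, c, v, L, hL, h⟩ := hf
  refine ⟨ι, inferInstance, fun a => z * c a, v, L, hL, fun s hs => ?_⟩
  dsimp only
  rw [h s hs, Finset.mul_sum]
  exact Finset.sum_congr rfl fun a _ => by ring

lemma ExpRat.sub {n : ℕ} {f g : (Fin n → ℝ) → ℂ} (hf : ExpRat n f) (hg : ExpRat n g) :
    ExpRat n (fun s => f s - g s) := by
  have := hf.add (hg.const_mul (-1))
  simpa [sub_eq_add_neg] using this

lemma ExpRat.sum {n : ℕ} {κ : Type*} (S : Finset κ) {f : κ → (Fin n → ℝ) → ℂ}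
    (hf : ∀ i ∈ S, ExpRat n (f i)) :
    ExpRat n (fun s => ∑ i ∈ S, f i s) := by
  classical
  induction S using Finset.induction_on with
  | empty => simpa using ExpRat.zero n
  | insert u S hu ih =>
    simp only [Finset.sum_insert hu]
    exact (hf u (Finset.mem_insert_self _ _)).add (ih fun i hi => hf i (Finset.mem_insert_of_mem hi))

lemma ExpRat.congr_off {n : ℕ} {f g : (Fin (n+1) → ℝ) → ℂ} (hg : ExpRat (n+1) g)
    (h : ∀ s, s 0 ≠ 0 → f s = g s) : ExpRat (n+1) f := by
  obtain ⟨ι, _, c, v, L, hL, hh⟩ := hg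
  refine ⟨Option ι, inferInstance, fun a => a.elim 0 c, fun a => a.elim 0 v,
    fun a => a.elim (fun _ => Pi.single 0 1) L, ?_, ?_⟩
  · rintro (_ | a) k
    · simp
    · exact hL a k
  · intro s hs
    have h0 : s 0 ≠ 0 := by simpa using hs none 0
    rw [h s h0, hh s (fun a k => hs (some a) k)]
    simp [Fintype.sum_option]

lemma ExpRat.lift {n : ℕ} {f : (Fin n → ℝ) → ℂ} (hf : ExpRat n f) (α : Fin n → ℝ) (β : ℝ) :
    ExpRat (n+1) (fun s => (Complex.I * (s 0 : ℂ))⁻¹ * Complex.exp (-Complex.I * (s 0 * β : ℝ)) *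
      f (fun j => s j.succ + s 0 * α j)) := by
  obtain ⟨ι, _, c, v, L, hL, h⟩ := hf
  refine ⟨ι, inferInstance, fun a => c a * Complex.I⁻¹, fun a => Fin.cons (β + v a ⬝ᵥ α) (v a),
    fun a => Fin.cons (Pi.single 0 1) (fun k => Fin.cons (L a k ⬝ᵥ α) (L a k)), ?_, ?_⟩
  · intro a k
    refine Fin.cases ?_ (fun k => ?_) k
    · simp
    · intro h0
      apply hL a k
      funext j
      have := congrFun h0 j.succ
      simpa using this
  · intro s hs
    have key : ∀ (w : Fin n → ℝ), w ⬝ᵥ (fun j => s j.succ + s 0 * α j) =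
        (w ⬝ᵥ α) * s 0 + ∑ j, w j * s j.succ := by
      intro w
      simp only [dotProduct, Finset.sum_mul, ← Finset.sum_add_distrib]
      exact Finset.sum_congr rfl fun j _ => by ring
    have key2 : ∀ (b : ℝ) (w : Fin n → ℝ), (Fin.cons b w : Fin (n+1) → ℝ) ⬝ᵥ s =
        b * s 0 + ∑ j, w j * s j.succ := by
      intro b w
      simp [dotProduct, Fin.sum_univ_succ]
    dsimp only
    rw [h _ (fun a k => by
      have := hs a k.succ
      simp only [Fin.cons_succ] at this
      rwa [key2, ← key] at this), Finset.mul_sum]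
    refine Finset.sum_congr rfl fun a _ => ?_
    rw [Fin.prod_univ_succ]
    simp only [Fin.cons_succ, Fin.cons_zero, key2, key]
    have : (Pi.single 0 1 : Fin (n+1) → ℝ) ⬝ᵥ s = s 0 := by simp
    rw [this]
    have e : Complex.exp (-Complex.I * (((β + v a ⬝ᵥ α) * s 0 + ∑ j, v a j * s j.succ : ℝ) : ℂ)) =
      Complex.exp (-Complex.I * (s 0 * β : ℝ)) *
      Complex.exp (-Complex.I * ((v a ⬝ᵥ α * s 0 + ∑ j, v a j * s j.succ : ℝ) : ℂ)) := by
      rw [← Complex.exp_add]; congr 1; push_cast; ring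
    rw [e]
    simp only [div_eq_mul_inv, mul_inv]
    ring

abbrev Aff (n : ℕ) := (Fin n → ℝ) × ℝ

def Aff.ev {n : ℕ} (c : Aff n) (x : Fin n → ℝ) : ℝ := c.1 ⬝ᵥ x + c.2

lemma Aff.ev_sub {n : ℕ} (c d : Aff n) (x : Fin n → ℝ) :
    Aff.ev (c - d) x = Aff.ev c x - Aff.ev d x := by
  simp only [Aff.ev, Prod.fst_sub, Prod.snd_sub, sub_dotProduct]; ring

lemma Aff.ev_neg {n : ℕ} (c : Aff n) (x : Fin n → ℝ) :
    Aff.ev (-c) x = - Aff.ev c x := by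
  simp only [Aff.ev, Prod.fst_neg, Prod.snd_neg, neg_dotProduct]; ring

lemma Aff.continuous_ev {n : ℕ} (c : Aff n) : Continuous (Aff.ev c) := by
  unfold Aff.ev; simp only [dotProduct]; fun_prop

open MeasureTheory in
lemma Aff.ae_ne {n : ℕ} {c : Aff n} (hc : c ≠ 0) : ∀ᵐ x : Fin n → ℝ, Aff.ev c x ≠ 0 := by
  by_cases h1 : c.1 = 0
  · have h2 : c.2 ≠ 0 := fun h2 => hc (Prod.ext h1 h2)
    exact Filter.Eventually.of_forall fun x => by simp [Aff.ev, h1, h2]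
  · let S : AffineSubspace ℝ (Fin n → ℝ) :=
      { carrier := {x | Aff.ev c x = 0}
        smul_vsub_vadd_mem' := by
          intro r p1 p2 p3 h1 h2 h3
          simp only [Set.mem_ofPred_eq, Aff.ev, vsub_eq_sub, vadd_eq_add, dotProduct_add,
            dotProduct_smul, dotProduct_sub, smul_eq_mul] at *
          linear_combination r * h1 - r * h2 + h3 }
    have hS : S ≠ ⊤ := by
      intro h
      have hm : ∀ x, Aff.ev c x = 0 := fun x => by
        have : x ∈ S := h ▸ AffineSubspace.mem_top ℝ _ x
        exact this
      have h0 := hm 0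
      have h3 := hm c.1
      simp only [Aff.ev, dotProduct_zero, zero_add] at h0 h3
      rw [h0, add_zero, dotProduct_self_eq_zero] at h3
      exact h1 h3
    have := Measure.addHaar_affineSubspace (volume : Measure (Fin n → ℝ)) S hS
    rw [ae_iff]
    convert! this using 2
    ext x
    simp only [not_not]
    exact Iff.rfl

def polyh {n : ℕ} (C : Finset (Aff n)) : Set (Fin n → ℝ) := {x | ∀ c ∈ C, 0 < Aff.ev c x}

lemma polyh_isOpen {n : ℕ} (C : Finset (Aff n)) : IsOpen (polyh C) := by
  have : polyh C = ⋂ c ∈ C, {x | 0 < Aff.ev c x} := by ext; simp [polyh]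
  rw [this]
  exact isOpen_biInter_finset fun c _ => isOpen_lt continuous_const c.continuous_ev

lemma polyh_convex {n : ℕ} (C : Finset (Aff n)) : Convex ℝ (polyh C) := by
  intro x hx y hy a b ha hb hab c hc
  have h1 := hx c hc
  have h2 := hy c hc
  have : Aff.ev c (a • x + b • y) = a * Aff.ev c x + b * Aff.ev c y := by
    simp only [Aff.ev, dotProduct_add, dotProduct_smul, smul_eq_mul]
    linear_combination (- c.2) * hab
  rw [this]
  rcases ha.eq_or_lt with rfl | ha
  · simp at hab; simp [hab, h2]
  · have := mul_pos ha h1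
    have := mul_nonneg hb h2.le
    linarith

open Classical in
noncomputable def pieceC {n : ℕ} (Lo Up Z : Finset (Aff n)) (l u : Aff n) : Finset (Aff n) :=
  (Lo.erase l).image (fun l' => l - l') ∪ (Up.erase u).image (fun u' => u' - u) ∪ {u - l} ∪ Z

lemma mem_pieceC {n : ℕ} {Lo Up Z : Finset (Aff n)} {l u : Aff n} {x : Fin n → ℝ} :
    x ∈ polyh (pieceC Lo Up Z l u) ↔ (∀ l' ∈ Lo, l' ≠ l → Aff.ev l' x < Aff.ev l x) ∧
      (∀ u' ∈ Up, u' ≠ u → Aff.ev u x < Aff.ev u' x) ∧ Aff.ev l x < Aff.ev u x ∧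
      ∀ z ∈ Z, 0 < Aff.ev z x := by
  classical
  simp only [polyh, pieceC, Set.mem_ofPred_eq, Finset.mem_union, Finset.mem_image, Finset.mem_erase,
    Finset.mem_singleton]
  constructor
  · intro h
    refine ⟨fun l' hl hne => ?_, fun u' hu hne => ?_, ?_, fun z hz => h z (Or.inr hz)⟩
    · have := h (l - l') (Or.inl (Or.inl (Or.inl ⟨l', ⟨hne, hl⟩, rfl⟩)))
      rw [Aff.ev_sub] at this; linarith
    · have := h (u' - u) (Or.inl (Or.inl (Or.inr ⟨u', ⟨hne, hu⟩, rfl⟩)))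
      rw [Aff.ev_sub] at this; linarith
    · have := h (u - l) (Or.inl (Or.inr rfl))
      rw [Aff.ev_sub] at this; linarith
  · rintro ⟨h1, h2, h3, h4⟩ c (((⟨l', ⟨hne, hl⟩, rfl⟩ | ⟨u', ⟨hne, hu⟩, rfl⟩) | rfl) | hz)
    · rw [Aff.ev_sub]; linarith [h1 l' hl hne]
    · rw [Aff.ev_sub]; linarith [h2 u' hu hne]
    · rw [Aff.ev_sub]; linarith
    · exact h4 c hz

open MeasureTheory in
lemma slice_integral {n : ℕ} (Lo Up Z : Finset (Aff n)) (hLo : Lo.Nonempty) (hUp : Up.Nonempty)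
    (x : Fin n → ℝ) (hl : ∀ l ∈ Lo, ∀ l' ∈ Lo, l ≠ l' → Aff.ev l x ≠ Aff.ev l' x)
    (hu : ∀ l ∈ Up, ∀ l' ∈ Up, l ≠ l' → Aff.ev l x ≠ Aff.ev l' x) (s : ℝ) (hs : s ≠ 0) :
    ∫ y in {y : ℝ | (∀ l ∈ Lo, Aff.ev l x < y) ∧ (∀ u ∈ Up, y < Aff.ev u x) ∧ ∀ z ∈ Z, 0 < Aff.ev z x},
      Complex.exp (-Complex.I * (s * y : ℝ)) =
    ∑ l ∈ Lo, ∑ u ∈ Up, (polyh (pieceC Lo Up Z l u)).indicator (fun x =>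
      (Complex.I * s)⁻¹ * (Complex.exp (-Complex.I * (s * Aff.ev l x : ℝ)) -
        Complex.exp (-Complex.I * (s * Aff.ev u x : ℝ)))) x := by
  classical
  obtain ⟨l₀, hl₀, hlmax⟩ := Finset.exists_max_image Lo (fun l => Aff.ev l x) hLo
  obtain ⟨u₀, hu₀, humin⟩ := Finset.exists_min_image Up (fun l => Aff.ev l x) hUp
  by_cases hgood : Aff.ev l₀ x < Aff.ev u₀ x ∧ ∀ z ∈ Z, 0 < Aff.ev z x
  · have hset : {y : ℝ | (∀ l ∈ Lo, Aff.ev l x < y) ∧ (∀ u ∈ Up, y < Aff.ev u x) ∧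
        ∀ z ∈ Z, 0 < Aff.ev z x} = Set.Ioo (Aff.ev l₀ x) (Aff.ev u₀ x) := by
      ext y
      simp only [Set.mem_ofPred_eq, Set.mem_Ioo]
      exact ⟨fun h => ⟨h.1 _ hl₀, h.2.1 _ hu₀⟩, fun h => ⟨fun l hl => (hlmax l hl).trans_lt h.1,
        fun u hu => h.2.trans_le (humin u hu), hgood.2⟩⟩
    rw [hset, Finset.sum_eq_single l₀ ?_ (fun h => absurd hl₀ h), Finset.sum_eq_single u₀ ?_ (fun h => absurd hu₀ h)]
    · rw [Set.indicator_of_mem, ← integral_Ioc_eq_integral_Ioo, ← intervalIntegral.integral_of_le hgood.1.le]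
      · have hc : -Complex.I * (s:ℂ) ≠ 0 := by simp [hs]
        have := integral_exp_mul_complex (a := Aff.ev l₀ x) (b := Aff.ev u₀ x) hc
        simp only [Complex.ofReal_mul, ← mul_assoc]
        rw [this]
        have hs' : (s:ℂ) ≠ 0 := by exact_mod_cast hs
        have hI := Complex.I_ne_zero
        field_simp
        ring
      · rw [mem_pieceC]
        exact ⟨fun l hl' hne => lt_of_le_of_ne (hlmax l hl') (hl l hl' l₀ hl₀ hne),
          fun u hu' hne => lt_of_le_of_ne (humin u hu') (hu u₀ hu₀ u hu' hne.symm), hgood⟩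
    · intro u hu' hne
      rw [Set.indicator_of_notMem]
      rw [mem_pieceC]
      rintro ⟨-, h2, -⟩
      exact absurd (h2 u₀ hu₀ hne.symm) (not_lt.mpr (humin u hu'))
    · intro l hl' hne
      refine Finset.sum_eq_zero fun u hu' => ?_
      rw [Set.indicator_of_notMem]
      rw [mem_pieceC]
      rintro ⟨h1, -⟩
      exact absurd (h1 l₀ hl₀ hne.symm) (not_lt.mpr (hlmax l hl'))
  · have hset : {y : ℝ | (∀ l ∈ Lo, Aff.ev l x < y) ∧ (∀ u ∈ Up, y < Aff.ev u x) ∧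
        ∀ z ∈ Z, 0 < Aff.ev z x} = ∅ := by
      ext y
      simp only [Set.mem_ofPred_eq, Set.mem_empty_iff_false, iff_false]
      exact fun h => hgood ⟨(h.1 _ hl₀).trans (h.2.1 _ hu₀), h.2.2⟩
    rw [hset, setIntegral_empty, Finset.sum_eq_zero]
    intro l hl'
    refine Finset.sum_eq_zero fun u hu' => ?_
    rw [Set.indicator_of_notMem]
    rw [mem_pieceC]
    rintro ⟨h1, h2, h3, h4⟩
    refine hgood ⟨?_, h4⟩
    have e1 : l = l₀ := by
      by_contra hne
      exact absurd (h1 l₀ hl₀ (Ne.symm hne)) (not_lt.mpr (hlmax l hl'))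
    have e2 : u = u₀ := by
      by_contra hne
      exact absurd (h2 u₀ hu₀ (Ne.symm hne)) (not_lt.mpr (humin u hu'))
    rwa [e1, e2] at h3

open MeasureTheory in
lemma integrableOn_expdot {n : ℕ} {A : Set (Fin n → ℝ)} (hA : Bornology.IsBounded A) (s : Fin n → ℝ) :
    IntegrableOn (fun x => Complex.exp (-Complex.I * ((s ⬝ᵥ x : ℝ) : ℂ))) A := by
  have hc : Continuous (fun x : Fin n → ℝ => Complex.exp (-Complex.I * ((s ⬝ᵥ x : ℝ) : ℂ))) := by
    simp only [dotProduct]; fun_prop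
  have hK : IsCompact (closure A) := hA.isCompact_closure
  exact (hc.continuousOn.integrableOn_compact hK).mono_set subset_closure

lemma dot_cons {n : ℕ} (a : Fin (n+1) → ℝ) (y : ℝ) (x : Fin n → ℝ) :
    a ⬝ᵥ (Fin.cons y x : Fin (n+1) → ℝ) = a 0 * y + (fun j => a (Fin.succ j)) ⬝ᵥ x := by
  simp [dotProduct, Fin.sum_univ_succ]

open Classical in
lemma exists_slices {n : ℕ} (C : Finset (Aff (n+1))) : ∃ Lo Up Z : Finset (Aff n),
    ∀ (y : ℝ) (x : Fin n → ℝ), (Fin.cons y x : Fin (n+1) → ℝ) ∈ polyh C ↔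
      ((∀ l ∈ Lo, Aff.ev l x < y) ∧ (∀ u ∈ Up, y < Aff.ev u x) ∧ ∀ z ∈ Z, 0 < Aff.ev z x) := by
  refine ⟨(C.filter (fun c => 0 < c.1 0)).image (fun c => (fun j => -(c.1 0)⁻¹ * c.1 (Fin.succ j), -(c.1 0)⁻¹ * c.2)),
    (C.filter (fun c => c.1 0 < 0)).image (fun c => (fun j => -(c.1 0)⁻¹ * c.1 (Fin.succ j), -(c.1 0)⁻¹ * c.2)),
    (C.filter (fun c => c.1 0 = 0)).image (fun c => (fun j => c.1 (Fin.succ j), c.2)), ?_⟩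
  intro y x
  have key : ∀ c : Aff (n+1), Aff.ev ((fun j => -(c.1 0)⁻¹ * c.1 (Fin.succ j), -(c.1 0)⁻¹ * c.2) : Aff n) x
      = -(c.1 0)⁻¹ * ((fun j => c.1 (Fin.succ j)) ⬝ᵥ x + c.2) := by
    intro c
    simp only [Aff.ev, dotProduct, mul_add, Finset.mul_sum, mul_assoc]
  simp only [polyh, Set.mem_ofPred_eq, Finset.forall_mem_image, Finset.mem_filter, and_imp, key]
  have e1 : ∀ c : Aff (n+1), Aff.ev c (Fin.cons y x) = c.1 0 * y + ((fun j => c.1 (Fin.succ j)) ⬝ᵥ x + c.2) := by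
    intro c; rw [Aff.ev, dot_cons, add_assoc]
  simp only [e1]
  constructor
  · intro h
    refine ⟨fun c hc h0 => ?_, fun c hc h0 => ?_, fun c hc h0 => ?_⟩
    · have := h c hc
      have h2 := mul_pos (inv_pos.mpr h0) this
      rw [mul_add, inv_mul_cancel_left₀ h0.ne'] at h2
      linarith
    · have := h c hc
      have h2 := mul_neg_of_neg_of_pos (inv_lt_zero.mpr h0) this
      rw [mul_add, inv_mul_cancel_left₀ h0.ne] at h2
      linarith
    · have := h c hc
      rw [h0] at this
      simpa [Aff.ev] using this
  · rintro ⟨h1, h2, h3⟩ c hc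
    rcases lt_trichotomy (c.1 0) 0 with h0 | h0 | h0
    · have := mul_neg_of_neg_of_pos h0 (sub_pos.mpr (h2 hc h0))
      have h5 := mul_inv_cancel₀ h0.ne
      rw [mul_sub, ← mul_assoc, mul_neg, h5] at this
      linarith
    · have := h3 hc h0
      rw [h0]
      simpa [Aff.ev] using this
    · have := mul_pos h0 (sub_pos.mpr (h1 hc h0))
      have h5 := mul_inv_cancel₀ h0.ne'
      rw [mul_sub, ← mul_assoc, mul_neg, h5] at this
      linarith

open MeasureTheory in
theorem FT_polyh : ∀ (n : ℕ) (C : Finset (Aff n)), Bornology.IsBounded (polyh C) →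
    ExpRat n (FTs (polyh C)) := by
  intro n
  induction n with
  | zero => intro C _; exact ExpRat.dimZero _
  | succ n ih =>
    intro C hC
    obtain ⟨Lo, Up, Z, hmem⟩ := exists_slices C
    obtain ⟨R, hR⟩ := hC.exists_norm_le
    have hR0 : ∀ (y : ℝ) (x : Fin n → ℝ), (Fin.cons y x : Fin (n+1) → ℝ) ∈ polyh C → |y| ≤ R := by
      intro y x h
      have h1 := hR _ h
      have h2 := norm_le_pi_norm (Fin.cons y x : Fin (n+1) → ℝ) 0
      simp at h2
      linarith
    have hR1 : ∀ (y : ℝ) (x : Fin n → ℝ), (Fin.cons y x : Fin (n+1) → ℝ) ∈ polyh C → ∀ i, ‖x i‖ ≤ R := by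
      intro y x h i
      have h1 := hR _ h
      have h2 := norm_le_pi_norm (Fin.cons y x : Fin (n+1) → ℝ) i.succ
      simp only [Fin.cons_succ] at h2
      linarith
    by_cases hne : polyh C = ∅
    · have : FTs (polyh C) = fun _ => 0 := by funext s; simp [FTs, hne]
      rw [this]; exact ExpRat.zero _
    obtain ⟨p, hp⟩ := Set.nonempty_iff_ne_empty.mpr hne
    obtain ⟨y₀, x₀, rfl⟩ : ∃ (y : ℝ) (x : Fin n → ℝ), p = Fin.cons y x := ⟨p 0, Fin.tail p, (Fin.cons_self_tail p).symm⟩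
    have hLo : Lo.Nonempty := by
      by_contra hcon
      rw [Finset.not_nonempty_iff_eq_empty] at hcon
      have h1 := (hmem y₀ x₀).mp hp
      have h2 : (Fin.cons (min y₀ (-(R+1))) x₀ : Fin (n+1) → ℝ) ∈ polyh C := by
        rw [hmem]
        refine ⟨by simp [hcon], fun u hu => (min_le_left _ _).trans_lt (h1.2.1 u hu), h1.2.2⟩
      have h3 := abs_le.mp (hR0 _ _ h2)
      have := min_le_right y₀ (-(R+1))
      linarith
    have hUp : Up.Nonempty := by
      by_contra hcon
      rw [Finset.not_nonempty_iff_eq_empty] at hcon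
      have h1 := (hmem y₀ x₀).mp hp
      have h2 : (Fin.cons (max y₀ (R+1)) x₀ : Fin (n+1) → ℝ) ∈ polyh C := by
        rw [hmem]
        refine ⟨fun u hu => (h1.1 u hu).trans_le (le_max_left _ _), by simp [hcon], h1.2.2⟩
      have h3 := abs_le.mp (hR0 _ _ h2)
      have := le_max_right y₀ (R+1)
      linarith
    have hRnn : 0 ≤ R := (abs_nonneg _).trans (hR0 _ _ hp)
    have hbd : ∀ l ∈ Lo, ∀ u ∈ Up, Bornology.IsBounded (polyh (pieceC Lo Up Z l u)) := by
      intro l hl u hu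
      refine isBounded_iff_forall_norm_le.mpr ⟨R, fun x hx => ?_⟩
      rw [mem_pieceC] at hx
      obtain ⟨h1, h2, h3, h4⟩ := hx
      have : (Fin.cons ((Aff.ev l x + Aff.ev u x) / 2) x : Fin (n+1) → ℝ) ∈ polyh C := by
        rw [hmem]
        refine ⟨fun l' hl' => ?_, fun u' hu' => ?_, h4⟩
        · by_cases e : l' = l
          · rw [e]; linarith
          · have := h1 l' hl' e; linarith
        · by_cases e : u' = u
          · rw [e]; linarith
          · have := h2 u' hu' e; linarith
      exact (pi_norm_le_iff_of_nonneg hRnn).mpr (hR1 _ _ this)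
    -- the candidate
    have hcand : ExpRat (n+1) (fun s => ∑ l ∈ Lo, ∑ u ∈ Up,
        (((Complex.I * (s 0 : ℂ))⁻¹ * Complex.exp (-Complex.I * (s 0 * l.2 : ℝ)) *
          FTs (polyh (pieceC Lo Up Z l u)) (fun j => s j.succ + s 0 * l.1 j)) -
        ((Complex.I * (s 0 : ℂ))⁻¹ * Complex.exp (-Complex.I * (s 0 * u.2 : ℝ)) *
          FTs (polyh (pieceC Lo Up Z l u)) (fun j => s j.succ + s 0 * u.1 j)))) := by
      refine ExpRat.sum _ fun l hl => ExpRat.sum _ fun u hu => ?_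
      have := ih (pieceC Lo Up Z l u) (hbd l hl u hu)
      exact (this.lift _ _).sub (this.lift _ _)
    refine hcand.congr_off fun s hs => ?_
    -- Fubini
    have hmeas : MeasurableSet (polyh C) := (polyh_isOpen C).measurableSet
    have hint : Integrable ((polyh C).indicator
        (fun x => Complex.exp (-Complex.I * ((s ⬝ᵥ x : ℝ) : ℂ)))) :=
      (integrable_indicator_iff hmeas).mpr (integrableOn_expdot hC s)
    have hmp := (volume_preserving_piFinSuccAbove (fun _ : Fin (n + 1) => ℝ) 0).symm
    have hint2 := (hmp.integrable_comp_emb (MeasurableEquiv.measurableEmbedding _)).mpr hint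
    have hF : FTs (polyh C) s = ∫ x : Fin n → ℝ, ∫ y : ℝ, (polyh C).indicator
        (fun x => Complex.exp (-Complex.I * ((s ⬝ᵥ x : ℝ) : ℂ))) (Fin.cons y x) := by
      rw [FTs, ← integral_indicator hmeas, ← hmp.integral_comp']
      rw [Measure.volume_eq_prod] at hint2 ⊢
      refine (integral_prod_symm _ hint2).trans ?_
      simp [MeasurableEquiv.piFinSuccAbove_symm_apply, Fin.insertNthEquiv]
    have hin : ∀ x : Fin n → ℝ, ∫ y : ℝ, (polyh C).indicator
        (fun x => Complex.exp (-Complex.I * ((s ⬝ᵥ x : ℝ) : ℂ))) (Fin.cons y x : Fin (n+1) → ℝ) =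
        Complex.exp (-Complex.I * (((fun j => s (Fin.succ j)) ⬝ᵥ x : ℝ) : ℂ)) *
        ∫ y in {y : ℝ | (∀ l ∈ Lo, Aff.ev l x < y) ∧ (∀ u ∈ Up, y < Aff.ev u x) ∧ ∀ z ∈ Z, 0 < Aff.ev z x},
          Complex.exp (-Complex.I * (s 0 * y : ℝ)) := by
      intro x
      have hm2 : MeasurableSet {y : ℝ | (∀ l ∈ Lo, Aff.ev l x < y) ∧ (∀ u ∈ Up, y < Aff.ev u x) ∧
          ∀ z ∈ Z, 0 < Aff.ev z x} := by
        have : {y : ℝ | (∀ l ∈ Lo, Aff.ev l x < y) ∧ (∀ u ∈ Up, y < Aff.ev u x) ∧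
          ∀ z ∈ Z, 0 < Aff.ev z x} = (fun y : ℝ => (Fin.cons y x : Fin (n+1) → ℝ)) ⁻¹' polyh C := by
          ext y; exact (hmem y x).symm
        rw [this]
        have hcc : Continuous (fun y : ℝ => (Fin.cons y x : Fin (n+1) → ℝ)) := by fun_prop
        exact hcc.measurable hmeas
      rw [← integral_indicator hm2, ← integral_const_mul]
      congr 1
      funext y
      have hmi : (Fin.cons y x : Fin (n+1) → ℝ) ∈ polyh C ↔ y ∈ {y : ℝ | (∀ l ∈ Lo, Aff.ev l x < y) ∧
          (∀ u ∈ Up, y < Aff.ev u x) ∧ ∀ z ∈ Z, 0 < Aff.ev z x} := hmem y x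
      by_cases hy : (Fin.cons y x : Fin (n+1) → ℝ) ∈ polyh C
      · rw [Set.indicator_of_mem hy, Set.indicator_of_mem (hmi.mp hy), ← Complex.exp_add, dot_cons]
        congr 1; push_cast; ring
      · rw [Set.indicator_of_notMem hy, Set.indicator_of_notMem (fun h => hy (hmi.mpr h)), mul_zero]
    have hties : ∀ S : Finset (Aff n), ∀ᵐ x : Fin n → ℝ, ∀ l ∈ S, ∀ l' ∈ S, l ≠ l' → Aff.ev l x ≠ Aff.ev l' x := by
      intro S
      rw [Filter.eventually_all_finset]
      intro l _
      rw [Filter.eventually_all_finset]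
      intro l' _
      by_cases h : l = l'
      · exact Filter.Eventually.of_forall fun x hx => absurd h hx
      · filter_upwards [Aff.ae_ne (sub_ne_zero.mpr h)] with x hx _
        rw [Aff.ev_sub] at hx
        exact sub_ne_zero.mp hx
    have hI : ∀ l ∈ Lo, ∀ u ∈ Up, ∀ w : Aff n, Integrable ((polyh (pieceC Lo Up Z l u)).indicator (fun x : Fin n → ℝ =>
        ((Complex.I * (s 0 : ℂ))⁻¹ * Complex.exp (-Complex.I * (s 0 * w.2 : ℝ)) *
          Complex.exp (-Complex.I * (((fun j => s (Fin.succ j) + s 0 * w.1 j) ⬝ᵥ x : ℝ) : ℂ))))) := by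
      intro l hl u hu w
      rw [integrable_indicator_iff (polyh_isOpen _).measurableSet]
      exact (integrableOn_expdot (hbd l hl u hu) _).const_mul _
    have hF2 : FTs (polyh C) s = ∫ x : Fin n → ℝ, ∑ l ∈ Lo, ∑ u ∈ Up,
        ((polyh (pieceC Lo Up Z l u)).indicator (fun x : Fin n → ℝ =>
        ((Complex.I * (s 0 : ℂ))⁻¹ * Complex.exp (-Complex.I * (s 0 * l.2 : ℝ)) *
          Complex.exp (-Complex.I * (((fun j => s (Fin.succ j) + s 0 * l.1 j) ⬝ᵥ x : ℝ) : ℂ)))) x -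
        (polyh (pieceC Lo Up Z l u)).indicator (fun x : Fin n → ℝ =>
        ((Complex.I * (s 0 : ℂ))⁻¹ * Complex.exp (-Complex.I * (s 0 * u.2 : ℝ)) *
          Complex.exp (-Complex.I * (((fun j => s (Fin.succ j) + s 0 * u.1 j) ⬝ᵥ x : ℝ) : ℂ)))) x) := by
      rw [hF]
      refine integral_congr_ae ?_
      filter_upwards [hties Lo, hties Up] with x h1 h2
      rw [hin x, slice_integral Lo Up Z hLo hUp x h1 h2 (s 0) hs, Finset.mul_sum]
      refine Finset.sum_congr rfl fun l _ => ?_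
      rw [Finset.mul_sum]
      refine Finset.sum_congr rfl fun u _ => ?_
      have ke : ∀ w : Aff n, Complex.exp (-Complex.I * (s 0 * w.2 : ℝ)) *
          Complex.exp (-Complex.I * (((fun j => s (Fin.succ j) + s 0 * w.1 j) ⬝ᵥ x : ℝ) : ℂ)) =
          Complex.exp (-Complex.I * (((fun j => s (Fin.succ j)) ⬝ᵥ x : ℝ) : ℂ)) *
          Complex.exp (-Complex.I * (s 0 * Aff.ev w x : ℝ)) := by
        intro w
        rw [← Complex.exp_add, ← Complex.exp_add]
        congr 1
        have : (fun j => s (Fin.succ j) + s 0 * w.1 j) ⬝ᵥ x =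
          (fun j => s (Fin.succ j)) ⬝ᵥ x + s 0 * (w.1 ⬝ᵥ x) := by
          simp only [dotProduct, Finset.mul_sum, ← Finset.sum_add_distrib]
          exact Finset.sum_congr rfl fun j _ => by ring
        rw [this, Aff.ev]
        push_cast; ring
      by_cases hx : x ∈ polyh (pieceC Lo Up Z l u)
      · simp only [Set.indicator_of_mem hx, mul_assoc, ke]
        ring
      · simp only [Set.indicator_of_notMem hx]; simp
    rw [hF2, integral_finsetSum]
    · refine Finset.sum_congr rfl fun l hl => ?_
      rw [integral_finsetSum]
      · refine Finset.sum_congr rfl fun u hu => ?_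
        rw [integral_sub (hI l hl u hu l) (hI l hl u hu u)]
        simp only [integral_indicator (polyh_isOpen _).measurableSet, integral_const_mul, FTs]
      · exact fun u hu => (hI l hl u hu l).sub (hI l hl u hu u)
    · exact fun l hl => integrable_finsetSum _ fun u hu => (hI l hl u hu l).sub (hI l hl u hu u)

open MeasureTheory in
lemma expRat_of_frontier {n : ℕ} (A : Set (Fin n → ℝ)) (hA : Bornology.IsBounded A)
    (H : Finset (Aff n)) (hH : ∀ h ∈ H, h ≠ 0) (hfr : ∀ x ∈ frontier A, ∃ h ∈ H, Aff.ev h x = 0) :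
    ExpRat n (FTs A) := by
  classical
  let cell : Finset (Aff n) → Finset (Aff n) := fun T => T ∪ (H \ T).image (fun h => -h)
  have hcell : ∀ T ⊆ H, ∀ x, x ∈ polyh (cell T) ↔ (∀ h ∈ H, Aff.ev h x ≠ 0) ∧ T = H.filter (fun h => 0 < Aff.ev h x) := by
    intro T hT x
    simp only [polyh, cell, Set.mem_ofPred_eq, Finset.mem_union, Finset.mem_image, Finset.mem_sdiff]
    constructor
    · intro h
      have h1 : ∀ c ∈ T, 0 < Aff.ev c x := fun c hc => h c (Or.inl hc)
      have h2 : ∀ c ∈ H, c ∉ T → Aff.ev c x < 0 := fun c hc hcT => by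
        have := h (-c) (Or.inr ⟨c, ⟨hc, hcT⟩, rfl⟩)
        rw [Aff.ev_neg] at this; linarith
      refine ⟨fun c hc => ?_, ?_⟩
      · by_cases hcT : c ∈ T
        · exact (h1 c hcT).ne'
        · exact (h2 c hc hcT).ne
      · ext c
        rw [Finset.mem_filter]
        refine ⟨fun hc => ⟨hT hc, h1 c hc⟩, fun hc => ?_⟩
        by_contra hcT
        exact absurd (h2 c hc.1 hcT) (not_lt.mpr hc.2.le)
    · rintro ⟨h1, h2⟩ c (hc | ⟨d, ⟨hd, hdT⟩, rfl⟩)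
      · rw [h2, Finset.mem_filter] at hc; exact hc.2
      · rw [Aff.ev_neg]
        rw [h2, Finset.mem_filter] at hdT
        have := h1 d hd
        have h3 : ¬ 0 < Aff.ev d x := fun h => hdT ⟨hd, h⟩
        have := lt_of_le_of_ne (not_lt.mp h3) this
        linarith
  have hdich : ∀ T ⊆ H, (polyh (cell T) ∩ A).Nonempty → polyh (cell T) ⊆ A := by
    intro T hT hne
    by_contra hcon
    obtain ⟨y, hy, hyA⟩ := Set.not_subset.mp hcon
    have hcov : ∀ x ∈ polyh (cell T), x ∈ interior A ∨ x ∈ interior Aᶜ := by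
      intro x hx
      by_contra hc
      push Not at hc
      have hxf : x ∈ frontier A := by
        refine ⟨?_, hc.1⟩
        by_contra hx'
        exact hc.2 (by rw [interior_compl]; exact hx')
      obtain ⟨h, hh, h0⟩ := hfr x hxf
      exact ((hcell T hT x).mp hx).1 h hh h0
    obtain ⟨x, hx, hxA⟩ := hne
    have hxi : x ∈ interior A := (hcov x hx).resolve_right fun h => interior_subset h hxA
    have hyi : y ∈ interior Aᶜ := (hcov y hy).resolve_left fun h => hyA (interior_subset h)
    obtain ⟨z, -, hz1, hz2⟩ := (polyh_convex (cell T)).isPreconnected _ _ isOpen_interior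
      isOpen_interior (fun x hx => hcov x hx) ⟨x, hx, hxi⟩ ⟨y, hy, hyi⟩
    exact interior_subset hz2 (interior_subset hz1)
  let TT : Finset (Finset (Aff n)) := H.powerset.filter (fun T => polyh (cell T) ⊆ A)
  have hTT : ∀ T ∈ TT, T ⊆ H ∧ polyh (cell T) ⊆ A := fun T hT => by
    simpa [TT] using hT
  have hae : ∀ᵐ x : Fin n → ℝ, ∀ h ∈ H, Aff.ev h x ≠ 0 := by
    rw [Filter.eventually_all_finset]
    exact fun h hh => Aff.ae_ne (hH h hh)
  have hset : A =ᵐ[volume] (⋃ T ∈ TT, polyh (cell T) : Set (Fin n → ℝ)) := by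
    filter_upwards [hae] with x hx
    apply propext
    change x ∈ A ↔ x ∈ (⋃ T ∈ TT, polyh (cell T) : Set (Fin n → ℝ))
    rw [Set.mem_iUnion₂]
    constructor
    · intro hxA
      have hm : x ∈ polyh (cell (H.filter (fun h => 0 < Aff.ev h x))) :=
        (hcell _ (Finset.filter_subset _ _) x).mpr ⟨hx, rfl⟩
      refine ⟨H.filter (fun h => 0 < Aff.ev h x), ?_, hm⟩
      simp only [TT, Finset.mem_filter, Finset.mem_powerset]
      exact ⟨Finset.filter_subset _ _, hdich _ (Finset.filter_subset _ _) ⟨x, hm, hxA⟩⟩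
    · rintro ⟨T, hT, hx⟩
      exact (hTT T hT).2 hx
  have : FTs A = fun s => ∑ T ∈ TT, FTs (polyh (cell T)) s := by
    funext s
    rw [FTs, setIntegral_congr_set hset, integral_biUnion_finset]
    · rfl
    · exact fun T _ => (polyh_isOpen _).measurableSet
    · intro T hT T' hT' hne
      refine Set.disjoint_left.mpr fun x hx hx' => hne ?_
      rw [((hcell T (hTT T hT).1 x).mp hx).2, ← ((hcell T' (hTT T' hT').1 x).mp hx').2]
    · exact fun T hT => integrableOn_expdot (hA.subset (hTT T hT).2) s
  rw [this]
  exact ExpRat.sum _ fun T hT => FT_polyh n _ (hA.subset (hTT T hT).2)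

lemma polytope_frontier {n : ℕ} {Q : Set (EuclideanSpace ℝ (Fin n))} (hQ : IsConvexPolytope Q) :
    ∃ H : Finset (Aff n), (∀ h ∈ H, h ≠ 0) ∧ ∀ x ∈ frontier Q, ∃ h ∈ H, Aff.ev h x.ofLp = 0 := by
  classical
  obtain ⟨V, hV, hint⟩ := hQ
  have hconv : Convex ℝ Q := hV ▸ convex_convexHull ℝ _
  have hclosed : IsClosed Q := hV ▸ (V.finite_toSet.isClosed_convexHull (𝕜 := ℝ))
  let ex : Finset (EuclideanSpace ℝ (Fin n)) → Prop := fun W => ∃ h : Aff n, h ≠ 0 ∧ ∀ w ∈ W, Aff.ev h w.ofLp = 0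
  let pick : Finset (EuclideanSpace ℝ (Fin n)) → Aff n := fun W => if h : ex W then h.choose else (0, 1)
  refine ⟨V.powerset.image pick, ?_, ?_⟩
  · intro h hh
    obtain ⟨W, _, rfl⟩ := Finset.mem_image.mp hh
    by_cases hW : ex W
    · simp only [pick, hW, dif_pos]; exact hW.choose_spec.1
    · simp only [pick, hW, dif_neg, not_false_eq_true]
      intro h0
      simpa using congrArg Prod.snd h0
  · intro x hx
    have hxQ : x ∈ Q := hclosed.frontier_subset hx
    have hxi : x ∉ interior Q := hx.2
    obtain ⟨f, hf⟩ := geometric_hahn_banach_open_point hconv.interior isOpen_interior hxi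
    obtain ⟨p, hp⟩ := hint
    have hfQ : ∀ y ∈ Q, f y ≤ f x := by
      intro y hy
      have hy' : y ∈ closure (interior Q) := by
        rw [hconv.closure_interior_eq_closure_of_nonempty_interior ⟨p, hp⟩]; exact subset_closure hy
      exact closure_minimal (fun z hz => (hf z hz).le : interior Q ⊆ {z | f z ≤ f x})
        (isClosed_le f.continuous continuous_const) hy'
    let W := V.filter (fun v => f v = f x)
    have hW : ex W := by
      let a := (InnerProductSpace.toDual ℝ (EuclideanSpace ℝ (Fin n))).symm f
      have ha : ∀ y, a.ofLp ⬝ᵥ y.ofLp = f y := by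
        intro y
        have h := InnerProductSpace.toDual_symm_apply (𝕜 := ℝ) (x := y) (y := f)
        rw [PiLp.inner_apply] at h
        rw [← h]
        simp only [a, dotProduct]
        exact Finset.sum_congr rfl fun i _ => by simp [mul_comm]
      refine ⟨(a.ofLp, - f x), ?_, ?_⟩
      · intro h0
        have h1 : a.ofLp = 0 := congrArg Prod.fst h0
        have h2 : ∀ y, f y = 0 := fun y => by rw [← ha y, h1, zero_dotProduct]
        have := hf p hp
        rw [h2, h2] at this
        exact lt_irrefl _ this
      · intro w hw
        rw [Aff.ev, ha, (Finset.mem_filter.mp hw).2]; simp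
    refine ⟨pick W, Finset.mem_image_of_mem _ (Finset.mem_powerset.mpr (Finset.filter_subset _ _)), ?_⟩
    have hpick : ∀ w ∈ W, Aff.ev (pick W) w.ofLp = 0 := by
      simp only [pick, hW, dif_pos]; exact hW.choose_spec.2
    rw [hV, Finset.mem_convexHull'] at hxQ
    obtain ⟨w, hw0, hw1, hwx⟩ := hxQ
    have hVQ : ∀ v ∈ V, f v ≤ f x := fun v hv => hfQ v (hV ▸ subset_convexHull ℝ _ hv)
    have hsum : ∑ v ∈ V, w v * (f x - f v) = 0 := by
      simp only [mul_sub, Finset.sum_sub_distrib, ← Finset.sum_mul, hw1]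
      rw [← hwx]
      simp
    have hterm := (Finset.sum_eq_zero_iff_of_nonneg (fun v hv =>
      mul_nonneg (hw0 v hv) (sub_nonneg.mpr (hVQ v hv)))).mp hsum
    have hx2 : x.ofLp = ∑ v ∈ V, w v • v.ofLp := by
      rw [← hwx]; simp
    have : Aff.ev (pick W) x.ofLp = ∑ v ∈ V, w v * Aff.ev (pick W) v.ofLp := by
      simp only [Aff.ev, mul_add, Finset.sum_add_distrib, ← Finset.sum_mul, hw1, one_mul]
      rw [hx2, dotProduct_sum]
      simp
    rw [this]
    refine Finset.sum_eq_zero fun v hv => ?_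
    rcases mul_eq_zero.mp (hterm v hv) with h | h
    · rw [h, zero_mul]
    · rw [hpick v (Finset.mem_filter.mpr ⟨hv, by linarith⟩), mul_zero]

lemma gen_closed_bdd {n : ℕ} {P : Set (EuclideanSpace ℝ (Fin n))} (hP : IsGenPolytope P) :
    IsCompact P ∧ P ⊆ closure (interior P) := by
  obtain ⟨k, Q, hQ, rfl⟩ := hP
  constructor
  · refine isCompact_iUnion fun i => ?_
    obtain ⟨V, hV, -⟩ := hQ i
    rw [hV]
    exact V.finite_toSet.isCompact_convexHull ℝ
  · refine Set.iUnion_subset fun i => ?_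
    obtain ⟨V, hV, hint⟩ := hQ i
    have hconv : Convex ℝ (Q i) := hV ▸ convex_convexHull ℝ _
    refine (subset_closure.trans (hconv.closure_interior_eq_closure_of_nonempty_interior hint).symm.subset).trans ?_
    exact closure_mono (interior_mono (Set.subset_iUnion _ i))

lemma gen_frontier {n : ℕ} {P : Set (EuclideanSpace ℝ (Fin n))} (hP : IsGenPolytope P) :
    ∃ H : Finset (Aff n), (∀ h ∈ H, h ≠ 0) ∧ ∀ x ∈ frontier P, ∃ h ∈ H, Aff.ev h x.ofLp = 0 := by
  classical
  obtain ⟨k, Q, hQ, rfl⟩ := hP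
  choose H h1 h2 using fun i => polytope_frontier (hQ i)
  refine ⟨Finset.univ.biUnion H, ?_, ?_⟩
  · intro h hh
    obtain ⟨i, _, hi⟩ := Finset.mem_biUnion.mp hh
    exact h1 i h hi
  · intro x hx
    have hc := hx.1
    rw [closure_iUnion_of_finite] at hc
    obtain ⟨i, hi⟩ := Set.mem_iUnion.mp hc
    obtain ⟨h, hh, h0⟩ := h2 i x ⟨hi, fun hxi => hx.2 (interior_mono (Set.subset_iUnion _ i) hxi)⟩
    exact ⟨h, Finset.mem_biUnion.mpr ⟨i, Finset.mem_univ _, hh⟩, h0⟩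

open MeasureTheory in
lemma gen_expRat {n : ℕ} {P : Set (EuclideanSpace ℝ (Fin n))} (hP : IsGenPolytope P) :
    ExpRat n (fun s => fourierTransformSet P (WithLp.toLp 2 s)) := by
  obtain ⟨H, h1, h2⟩ := gen_frontier hP
  let e : (Fin n → ℝ) ≃ₜ EuclideanSpace ℝ (Fin n) := (PiLp.homeomorph 2 (fun _ : Fin n => ℝ)).symm
  have hfun : (fun s => fourierTransformSet P (WithLp.toLp 2 s)) = FTs (e ⁻¹' P) := by
    funext s
    have := (PiLp.volume_preserving_toLp (Fin n)).setIntegral_preimage_emb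
      (MeasurableEquiv.toLp 2 (Fin n → ℝ)).measurableEmbedding
      (fun x : EuclideanSpace ℝ (Fin n) => Complex.exp (-Complex.I * ((inner ℝ (WithLp.toLp 2 s) x : ℝ) : ℂ))) P
    rw [fourierTransformSet, ← this, FTs]
    refine integral_congr_ae (Filter.Eventually.of_forall fun x => ?_)
    simp [PiLp.inner_apply, dotProduct, mul_comm]
  rw [hfun]
  refine expRat_of_frontier _ ?_ H h1 ?_
  · have : IsCompact (e ⁻¹' P) := e.isCompact_preimage.mpr (gen_closed_bdd hP).1
    exact this.isBounded
  · intro x hx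
    rw [← e.preimage_frontier] at hx
    exact h2 _ hx

open MeasureTheory in
lemma eq_of_fourier_ae {n : ℕ} {P₁ P₂ : Set (EuclideanSpace ℝ (Fin n))} (h₁ : IsGenPolytope P₁)
    (h₂ : IsGenPolytope P₂) (h : ∀ᵐ s : Fin n → ℝ,
      fourierTransformSet P₁ (WithLp.toLp 2 s) - fourierTransformSet P₂ (WithLp.toLp 2 s) = 0) :
    P₁ = P₂ := by
  obtain ⟨c₁, r₁⟩ := gen_closed_bdd h₁
  obtain ⟨c₂, r₂⟩ := gen_closed_bdd h₂
  have : IsFiniteMeasure (volume.restrict P₁) := isFiniteMeasure_restrict.mpr c₁.measure_lt_top.ne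
  have : IsFiniteMeasure (volume.restrict P₂) := isFiniteMeasure_restrict.mpr c₂.measure_lt_top.ne
  have hF : ∀ (P : Set (EuclideanSpace ℝ (Fin n))) s,
      fourierTransformSet P s = charFun (volume.restrict P) (-s) := by
    intro P s
    rw [fourierTransformSet, charFun_apply]
    congr 1
    funext x
    rw [inner_neg_right, real_inner_comm]
    push_cast
    ring_nf
  have hcont : ∀ P : Set (EuclideanSpace ℝ (Fin n)), IsFiniteMeasure (volume.restrict P) →
      Continuous (fun s : Fin n → ℝ => fourierTransformSet P (WithLp.toLp 2 s)) := by
    intro P hP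
    simp only [hF]
    exact continuous_charFun.comp (PiLp.continuous_toLp 2 _).neg
  have heq := (Continuous.ae_eq_iff_eq (volume : Measure (Fin n → ℝ)) ((hcont P₁ inferInstance).sub
    (hcont P₂ inferInstance)) (continuous_const (y := (0:ℂ)))).mp h
  have hm : volume.restrict P₁ = volume.restrict P₂ := by
    apply Measure.ext_of_charFun
    funext t
    have h3 : fourierTransformSet P₁ (-t) - fourierTransformSet P₂ (-t) = 0 := congrFun heq (-t).ofLp
    rw [hF, hF, neg_neg] at h3
    exact sub_eq_zero.mp h3
  have key : ∀ P Q : Set (EuclideanSpace ℝ (Fin n)), IsCompact Q → P ⊆ closure (interior P) →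
      volume.restrict P = volume.restrict Q → P ⊆ Q := by
    intro P Q hQ hP hPQ
    have ho : IsOpen (interior P \ Q) := isOpen_interior.sdiff hQ.isClosed
    have h0 : volume (interior P \ Q) = 0 := by
      have h1 : (volume.restrict P) (interior P \ Q) = volume (interior P \ Q) := by
        rw [Measure.restrict_apply ho.measurableSet]
        congr 1
        exact Set.inter_eq_left.mpr (Set.sdiff_subset.trans interior_subset)
      rw [← h1, hPQ, Measure.restrict_apply ho.measurableSet]
      simp
    have he : interior P \ Q = ∅ := (ho.measure_eq_zero_iff volume).mp h0
    exact hP.trans (closure_minimal (Set.sdiff_eq_empty.mp he) hQ.isClosed)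
  exact (key _ _ c₂ r₁ hm).antisymm (key _ _ c₁ r₂ hm.symm)

lemma expRat_poly {n : ℕ} {f : (Fin n → ℝ) → ℂ} (hf : ExpRat n f) :
    ∃ (S : Finset (Fin n → ℝ)) (M : ℕ) (Q : (Fin n → ℝ) → MvPolynomial (Fin n) ℂ),
      (∀ w, (Q w).IsHomogeneous M) ∧
      (∀ s : Fin n → ℝ, f s = 0 → ∑ w ∈ S, MvPolynomial.eval (fun i => (s i : ℂ)) (Q w) *
        Complex.exp (-Complex.I * ((w ⬝ᵥ s : ℝ) : ℂ)) = 0) ∧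
      (∀ᵐ s : Fin n → ℝ, (∀ w ∈ S, MvPolynomial.eval (fun i => (s i : ℂ)) (Q w) = 0) → f s = 0) := by
  classical
  obtain ⟨ι, _, c, v, L, hL, h⟩ := hf
  let lin : (Fin n → ℝ) → MvPolynomial (Fin n) ℂ := fun l => ∑ j, MvPolynomial.C (l j : ℂ) * MvPolynomial.X j
  have hlin : ∀ l, (lin l).IsHomogeneous 1 := fun l =>
    MvPolynomial.IsHomogeneous.sum _ _ _ fun j _ => by
      simpa using (MvPolynomial.isHomogeneous_C (Fin n) (l j : ℂ)).mul (MvPolynomial.isHomogeneous_X ℂ j)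
  have hev : ∀ l s, MvPolynomial.eval (fun i => ((s i : ℝ) : ℂ)) (lin l) = ((l ⬝ᵥ s : ℝ) : ℂ) := by
    intro l s
    simp [lin, dotProduct]
  let T : ι → MvPolynomial (Fin n) ℂ := fun a => ∏ k, lin (L a k)
  have hT : ∀ a, (T a).IsHomogeneous n := fun a => by
    have := MvPolynomial.IsHomogeneous.prod Finset.univ (fun k => lin (L a k)) (fun _ => 1) (fun k _ => hlin _)
    simpa using this
  have hTe : ∀ a s, MvPolynomial.eval (fun i => ((s i : ℝ) : ℂ)) (T a) = ∏ k, ((L a k ⬝ᵥ s : ℝ) : ℂ) := by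
    intro a s; simp only [T, map_prod, hev]
  let E : ι → MvPolynomial (Fin n) ℂ := fun a => ∏ b ∈ Finset.univ.erase a, T b
  have hE : ∀ a, (E a).IsHomogeneous ((Fintype.card ι - 1) * n) := fun a => by
    have := MvPolynomial.IsHomogeneous.prod (Finset.univ.erase a) T (fun _ => n) (fun b _ => hT b)
    simpa using this
  let Dd : MvPolynomial (Fin n) ℂ := ∏ b, T b
  have hD : Dd.IsHomogeneous (Fintype.card ι * n) := by
    have := MvPolynomial.IsHomogeneous.prod (Finset.univ : Finset ι) T (fun _ => n) (fun b _ => hT b)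
    simpa using this
  have hDE : ∀ a, T a * E a = Dd := fun a => Finset.mul_prod_erase _ _ (Finset.mem_univ a)
  let p : (Fin n → ℝ) → MvPolynomial (Fin n) ℂ := fun w =>
    ∑ a ∈ Finset.univ.filter (fun a => v a = w), MvPolynomial.C (c a) * E a
  have hp : ∀ w, (p w).IsHomogeneous ((Fintype.card ι - 1) * n) := fun w =>
    MvPolynomial.IsHomogeneous.sum _ _ _ fun a _ => by
      simpa using (MvPolynomial.isHomogeneous_C (Fin n) (c a)).mul (hE a)
  let S : Finset (Fin n → ℝ) := Finset.univ.image v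
  -- regrouping
  have hgroup : ∀ s : Fin n → ℝ, (∀ a k, L a k ⬝ᵥ s ≠ 0) →
      MvPolynomial.eval (fun i => (s i : ℂ)) Dd * f s =
      ∑ w ∈ S, MvPolynomial.eval (fun i => (s i : ℂ)) (p w) *
        Complex.exp (-Complex.I * ((w ⬝ᵥ s : ℝ) : ℂ)) := by
    intro s hs
    rw [h s hs, Finset.mul_sum]
    rw [← Finset.sum_fiberwise_of_maps_to (s := Finset.univ) (t := S) (g := v)
      (fun a _ => Finset.mem_image_of_mem v (Finset.mem_univ a))]
    refine Finset.sum_congr rfl fun w _ => ?_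
    simp only [p, map_sum, Finset.sum_mul]
    refine Finset.sum_congr rfl fun a ha => ?_
    obtain rfl := (Finset.mem_filter.mp ha).2
    rw [← hDE a, map_mul, map_mul, hTe, MvPolynomial.eval_C]
    have h0 : ∏ k, ((L a k ⬝ᵥ s : ℝ) : ℂ) ≠ 0 :=
      Finset.prod_ne_zero_iff.mpr fun k _ => by exact_mod_cast hs a k
    field_simp
  have hDne : ∀ s : Fin n → ℝ, MvPolynomial.eval (fun i => (s i : ℂ)) Dd ≠ 0 ↔ (∀ a k, L a k ⬝ᵥ s ≠ 0) := by
    intro s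
    simp only [Dd, map_prod, hTe, Finset.prod_ne_zero_iff]
    simp
  refine ⟨S, _, fun w => Dd * p w, fun w => hD.mul (hp w), ?_, ?_⟩
  · intro s hs
    by_cases hD0 : MvPolynomial.eval (fun i => (s i : ℂ)) Dd = 0
    · exact Finset.sum_eq_zero fun w _ => by rw [map_mul, hD0, zero_mul, zero_mul]
    · have := hgroup s ((hDne s).mp hD0)
      rw [hs, mul_zero] at this
      simp only [map_mul, mul_assoc]
      rw [← Finset.mul_sum, ← this, mul_zero]
  · have hae : ∀ᵐ s : Fin n → ℝ, ∀ a k, L a k ⬝ᵥ s ≠ 0 := by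
      rw [Filter.eventually_all]; intro a
      rw [Filter.eventually_all]; intro k
      have := Aff.ae_ne (c := ((L a k, 0) : Aff n)) (fun h0 => hL a k (congrArg Prod.fst h0))
      simpa [Aff.ev] using this
    filter_upwards [hae] with s hs hw
    have hD0 := (hDne s).mpr hs
    have h1 := hgroup s hs
    rw [Finset.sum_eq_zero] at h1
    · exact (mul_eq_zero.mp h1).resolve_left hD0
    · intro w hwS
      have := hw w hwS
      rw [map_mul] at this
      rw [(mul_eq_zero.mp this).resolve_left hD0, zero_mul]

lemma common_denom {m n : ℕ} (O : Set (Fin m → ℝ)) (σ : (Fin m → ℝ) → Fin n → ℝ)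
    (hrat : ∀ j : Fin n, ∃ A B : MvPolynomial (Fin m) ℝ,
      ∀ t ∈ O, MvPolynomial.eval t B ≠ 0 ∧
        σ t j = MvPolynomial.eval t A / MvPolynomial.eval t B) :
    ∃ (A : Fin n → MvPolynomial (Fin m) ℝ) (B : MvPolynomial (Fin m) ℝ),
      ∀ t ∈ O, MvPolynomial.eval t B ≠ 0 ∧
        ∀ j, MvPolynomial.eval t (A j) = MvPolynomial.eval t B * σ t j := by
  classical
  choose A B h using hrat
  refine ⟨fun j => A j * ∏ k ∈ Finset.univ.erase j, B k, ∏ k, B k, fun t ht => ⟨?_, fun j => ?_⟩⟩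
  · rw [map_prod]
    exact Finset.prod_ne_zero_iff.mpr fun k _ => (h k t ht).1
  · rw [← Finset.mul_prod_erase _ _ (Finset.mem_univ j), map_mul, map_mul, (h j t ht).2]
    have := (h j t ht).1
    field_simp

lemma eval_ofReal {m : ℕ} (p : MvPolynomial (Fin m) ℝ) (t : Fin m → ℝ) :
    MvPolynomial.eval (fun i => (t i : ℂ)) (MvPolynomial.map Complex.ofRealHom p) =
      ((MvPolynomial.eval t p : ℝ) : ℂ) := by
  induction p using MvPolynomial.induction_on with
  | C a => simp
  | add p q hp hq => simp [hp, hq]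
  | mul_X p i hp => simp [hp]

lemma eval_bind {m n : ℕ} (g : Fin n → MvPolynomial (Fin m) ℂ) (p : MvPolynomial (Fin n) ℂ)
    (y : Fin m → ℂ) : MvPolynomial.eval y (MvPolynomial.bind₁ g p) =
      MvPolynomial.eval (fun j => MvPolynomial.eval y (g j)) p := by
  induction p using MvPolynomial.induction_on with
  | C a => simp
  | add p q hp hq => simp [hp, hq]
  | mul_X p i hp => simp [hp]

lemma homog_eval {n M : ℕ} {p : MvPolynomial (Fin n) ℂ} (hp : p.IsHomogeneous M) (r : ℂ)
    (x : Fin n → ℂ) : MvPolynomial.eval (fun i => r * x i) p = r ^ M * MvPolynomial.eval x p := by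
  rw [MvPolynomial.eval_eq, MvPolynomial.eval_eq, Finset.mul_sum]
  refine Finset.sum_congr rfl fun d hd => ?_
  have h1 : d.degree = M := by
    have := hp (MvPolynomial.mem_support_iff.mp hd)
    rw [Finsupp.degree_eq_weight_one]; exact this
  simp only [mul_pow, Finset.prod_mul_distrib]
  rw [Finset.prod_pow_eq_pow_sum]
  rw [Finsupp.degree_apply] at h1
  rw [← h1]; ring

lemma main_poly {m : ℕ} (S : Finset (Fin (m+1) → ℝ)) (M : ℕ)
    (Q : (Fin (m+1) → ℝ) → MvPolynomial (Fin (m+1)) ℂ) (hQ : ∀ w, (Q w).IsHomogeneous M)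
    (O : Set (Fin m → ℝ)) (hO : IsOpen O) (σ : (Fin m → ℝ) → Fin (m+1) → ℝ)
    (hrat : ∀ j : Fin (m+1), ∃ A B : MvPolynomial (Fin m) ℝ,
      ∀ t ∈ O, MvPolynomial.eval t B ≠ 0 ∧
        σ t j = MvPolynomial.eval t A / MvPolynomial.eval t B)
    (hne : ∀ t ∈ O, σ t 0 ≠ 0)
    (hhyp : ¬ ∃ (a : Fin (m + 1) → ℝ) (c : ℝ), a ≠ 0 ∧ ∀ t ∈ O, a ⬝ᵥ σ t = c)
    (hinner : ∃ t ∈ O, (fun i : Fin m => σ t i.succ / σ t 0) ∈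
      interior ((fun t' : Fin m → ℝ => fun i : Fin m => σ t' i.succ / σ t' 0) '' O))
    (hsum : ∀ t ∈ O, ∑ w ∈ S, MvPolynomial.eval (fun i => (σ t i : ℂ)) (Q w) *
        Complex.exp (-Complex.I * ((w ⬝ᵥ σ t : ℝ) : ℂ)) = 0) :
    ∀ w ∈ S, ∀ s : Fin (m+1) → ℝ, s 0 ≠ 0 → MvPolynomial.eval (fun i => (s i : ℂ)) (Q w) = 0 := by
  classical
  obtain ⟨A, B, hAB⟩ := common_denom O σ hrat
  let A' : Fin (m+1) → MvPolynomial (Fin m) ℂ := fun j => MvPolynomial.map Complex.ofRealHom (A j)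
  let B' : MvPolynomial (Fin m) ℂ := MvPolynomial.map Complex.ofRealHom B
  let N : (Fin (m+1) → ℝ) → MvPolynomial (Fin m) ℂ := fun w =>
    MvPolynomial.C (-Complex.I) * ∑ j, MvPolynomial.C (w j : ℂ) * A' j
  let P : (Fin (m+1) → ℝ) → MvPolynomial (Fin m) ℂ := fun w => MvPolynomial.bind₁ A' (Q w)
  have hB' : ∀ t ∈ O, MvPolynomial.eval (fun i => (t i : ℂ)) B' ≠ 0 := fun t ht => by
    rw [eval_ofReal]; exact_mod_cast (hAB t ht).1
  have hA' : ∀ t ∈ O, ∀ j, MvPolynomial.eval (fun i => (t i : ℂ)) (A' j) =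
      MvPolynomial.eval (fun i => (t i : ℂ)) B' * (σ t j : ℂ) := fun t ht j => by
    rw [eval_ofReal, eval_ofReal, (hAB t ht).2 j]; push_cast; rfl
  have hN : ∀ t ∈ O, ∀ w, MvPolynomial.eval (fun i => (t i : ℂ)) (N w) =
      MvPolynomial.eval (fun i => (t i : ℂ)) B' * (-Complex.I * ((w ⬝ᵥ σ t : ℝ) : ℂ)) := by
    intro t ht w
    simp only [N, map_mul, map_sum, MvPolynomial.eval_C, hA' t ht, dotProduct]
    push_cast
    simp only [Finset.mul_sum]
    exact Finset.sum_congr rfl fun j _ => by ring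
  have hP : ∀ t ∈ O, ∀ w, MvPolynomial.eval (fun i => (t i : ℂ)) (P w) =
      MvPolynomial.eval (fun i => (t i : ℂ)) B' ^ M * MvPolynomial.eval (fun i => (σ t i : ℂ)) (Q w) := by
    intro t ht w
    rw [← homog_eval (hQ w)]
    simp only [P]
    rw [eval_bind]
    simp only [hA' t ht]
  have hzero := exp_indep_multi S N P B' O hO hB' (by
    intro w _ w' _ hww
    rintro ⟨c, hc⟩
    apply hhyp
    refine ⟨w - w', (Complex.I * c).re, sub_ne_zero.mpr hww, fun t ht => ?_⟩
    have h1 := hc t ht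
    rw [map_sub, hN t ht, hN t ht, ← mul_sub, mul_comm c] at h1
    have h2 := mul_left_cancel₀ (hB' t ht) h1
    rw [← h2, sub_dotProduct]
    rw [← mul_sub, ← mul_assoc]
    simp) (by
    intro t ht
    have : ∀ w ∈ S, MvPolynomial.eval (fun i => (t i : ℂ)) (P w) *
        Complex.exp (MvPolynomial.eval (fun i => (t i : ℂ)) (N w) / MvPolynomial.eval (fun i => (t i : ℂ)) B') =
        MvPolynomial.eval (fun i => (t i : ℂ)) B' ^ M * (MvPolynomial.eval (fun i => (σ t i : ℂ)) (Q w) *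
          Complex.exp (-Complex.I * ((w ⬝ᵥ σ t : ℝ) : ℂ))) := by
      intro w _
      rw [hP t ht, hN t ht, mul_div_cancel_left₀ _ (hB' t ht), mul_assoc]
    rw [Finset.sum_congr rfl this, ← Finset.mul_sum, hsum t ht, mul_zero])
  intro w hw
  have hσ : ∀ t ∈ O, MvPolynomial.eval (fun i => (σ t i : ℂ)) (Q w) = 0 := fun t ht => by
    have := hzero w hw t ht
    rw [hP t ht] at this
    exact (mul_eq_zero.mp this).resolve_left (pow_ne_zero _ (hB' t ht))
  -- dehomogenise
  let R : MvPolynomial (Fin m) ℂ := MvPolynomial.bind₁ (Fin.cons 1 (fun i => MvPolynomial.X i)) (Q w)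
  have hR : ∀ y : Fin m → ℂ, MvPolynomial.eval y R = MvPolynomial.eval (Fin.cons 1 y : Fin (m+1) → ℂ) (Q w) := by
    intro y
    simp only [R]
    rw [eval_bind]
    congr 2
    funext i
    refine Fin.cases ?_ (fun i => ?_) i <;> simp
  have hscale : ∀ s : Fin (m+1) → ℝ, s 0 ≠ 0 → MvPolynomial.eval (fun i => (s i : ℂ)) (Q w) =
      (s 0 : ℂ) ^ M * MvPolynomial.eval (fun i : Fin m => ((s i.succ / s 0 : ℝ) : ℂ)) R := by
    intro s hs
    rw [hR, ← homog_eval (hQ w)]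
    congr 2
    funext i
    refine Fin.cases ?_ (fun i => ?_) i
    · simp
    · simp only [Fin.cons_succ]
      rw [← Complex.ofReal_mul, mul_div_cancel₀ _ hs]
  have hR0 : R = 0 := by
    obtain ⟨t, _, ht⟩ := hinner
    obtain ⟨ε, hε, hball⟩ := Metric.isOpen_iff.mp isOpen_interior _ ht
    refine MvPolynomial.funext_set (fun i => (fun x : ℝ => (x : ℂ)) '' Set.Ioo (σ t i.succ / σ t 0 - ε) (σ t i.succ / σ t 0 + ε)) ?_ ?_
    · intro i
      exact (Set.Ioo_infinite (by linarith)).image Complex.ofReal_injective.injOn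
    · intro x hx
      choose y hy hyx using fun i => hx i (Set.mem_univ i)
      have hyb : y ∈ Metric.ball (fun i : Fin m => σ t i.succ / σ t 0) ε := by
        rw [Metric.mem_ball, dist_pi_lt_iff hε]
        intro i
        rw [Real.dist_eq, abs_lt]
        constructor <;> linarith [(hy i).1, (hy i).2]
      obtain ⟨t', ht', hty⟩ := interior_subset (hball hyb)
      have h1 := hscale (σ t') (hne t' ht')
      rw [hσ t' ht'] at h1
      have h2 := (mul_eq_zero.mp h1.symm).resolve_left (pow_ne_zero _ (by exact_mod_cast hne t' ht'))
      have h3 : x = fun i : Fin m => ((σ t' i.succ / σ t' 0 : ℝ) : ℂ) := by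
        funext i
        rw [← hyx i, ← congrFun hty i]
      rw [h3, h2, map_zero]
  intro s hs
  rw [hscale s hs, hR0, map_zero, mul_zero]

/-- with `n = m + 1 ≥ 2`. If two generalized polytopes have equal Fourier
transforms on `σ(O)` for a rationally parameterisable hypersurface `σ` and an open nonempty
`O ⊆ D ∖ σ₁⁻¹(0)` satisfying the hyperplane condition and the inner point condition,
then the polytopes coincide. -/
theorem fourier_eq_on_rp_hypersurface_implies_eq
    (m : ℕ) (hm : 1 ≤ m)
    (P₁ P₂ : Set (EuclideanSpace ℝ (Fin (m + 1))))
    (hP₁ : IsGenPolytope P₁) (hP₂ : IsGenPolytope P₂)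
    (D : Set (Fin m → ℝ))
    (σ : (Fin m → ℝ) → EuclideanSpace ℝ (Fin (m + 1)))
    -- each component of σ is a rational function whose denominator does not vanish on D
    (hrat : ∀ j : Fin (m + 1), ∃ A B : MvPolynomial (Fin m) ℝ,
      ∀ t ∈ D, MvPolynomial.eval t B ≠ 0 ∧
        σ t j = MvPolynomial.eval t A / MvPolynomial.eval t B)
    (O : Set (Fin m → ℝ)) (hOopen : IsOpen O) (hOne : O.Nonempty)
    -- O ⊆ D ∖ σ₁⁻¹(0)
    (hOD : ∀ t ∈ O, t ∈ D ∧ σ t 0 ≠ 0)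
    -- hyperplane condition: σ(O) is not contained in an affine hyperplane
    (hhyp : ¬ ∃ (a : EuclideanSpace ℝ (Fin (m + 1))) (c : ℝ), a ≠ 0 ∧
      ∀ t ∈ O, ⟪a, σ t⟫ = c)
    -- inner point condition: some σ̂(t) is an interior point of σ̂(O)
    (hinner : ∃ t ∈ O, (fun i : Fin m => σ t i.succ / σ t 0) ∈
      interior ((fun t' : Fin m → ℝ => fun i : Fin m => σ t' i.succ / σ t' 0) '' O))
    (heq : ∀ t ∈ O, fourierTransformSet P₁ (σ t) = fourierTransformSet P₂ (σ t)) :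
    P₁ = P₂ := by
  have hf := (gen_expRat hP₁).sub (gen_expRat hP₂)
  obtain ⟨S, M, Q, hQ, h1, h2⟩ := expRat_poly hf
  have h3 := main_poly S M Q hQ O hOopen (fun t => (σ t).ofLp)
    (fun j => by
      obtain ⟨A, B, h⟩ := hrat j
      exact ⟨A, B, fun t ht => h t (hOD t ht).1⟩)
    (fun t ht => (hOD t ht).2)
    (by
      rintro ⟨a, c, ha, h⟩
      refine hhyp ⟨WithLp.toLp 2 a, c, fun h0 => ha (congrArg WithLp.ofLp h0), fun t ht => ?_⟩
      rw [← h t ht]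
      simp [PiLp.inner_apply, dotProduct, mul_comm])
    hinner
    (fun t ht => h1 _ (sub_eq_zero.mpr (heq t ht)))
  refine eq_of_fourier_ae hP₁ hP₂ ?_
  have h4 : ∀ᵐ s : Fin (m+1) → ℝ, s 0 ≠ 0 := by
    have := Aff.ae_ne (c := ((Pi.single 0 1, 0) : Aff (m+1))) (fun h0 => by
      have := congrFun (congrArg Prod.fst h0) 0
      simp at this)
    simpa [Aff.ev] using this
  filter_upwards [h2, h4] with s hs hs0
  exact hs fun w hw => h3 w hw s hs0
end

section
/- Let n ≥ 2, let 𝒫₁ and 𝒫₂ be generalized n-dimensional polytopes in ℝⁿ, and let S = {σ(t) : t ∈ D} be a rationally parameterisable hypersurface in ℝⁿ. Suppose O is a nonempty open subset of D ∖ σ₁⁻¹(0) in ℝ^{n−1} that satisfies the hyperplane condition and the inner point condition. If F_{𝒫₁}(σ(t)) = F_{𝒫₂}(σ(t)) for every t ∈ O, then F_{𝒫₁}(s) = F_{𝒫₂}(s) for every s ∈ ℝⁿ. -/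
open scoped RealInnerProductSpace

open MvPolynomial in
noncomputable def evc {n : ℕ} (p : MvPolynomial (Fin n) ℂ) (s : Fin n → ℝ) : ℂ :=
  MvPolynomial.eval (fun i => (s i : ℂ)) p

noncomputable def ee {n : ℕ} (s x : Fin n → ℝ) : ℂ :=
  Complex.exp (-Complex.I * ((s ⬝ᵥ x : ℝ) : ℂ))

def ERep {n : ℕ} (k : ℕ) (F : (Fin n → ℝ) → ℂ) : Prop :=
  ∃ (d : ℕ) (Q : MvPolynomial (Fin n) ℂ), Q ≠ 0 ∧ Q.IsHomogeneous (d + k) ∧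
    ∃ (ι : Type) (_ : Fintype ι) (p : ι → MvPolynomial (Fin n) ℂ) (v : ι → Fin n → ℝ),
      (∀ i, (p i).IsHomogeneous d) ∧
      ∀ s, evc Q s * F s = ∑ i, evc (p i) s * ee s (v i)

lemma evc_mul {n : ℕ} (p q : MvPolynomial (Fin n) ℂ) (s : Fin n → ℝ) :
    evc (p * q) s = evc p s * evc q s := by simp [evc]

lemma ERep.add {n k : ℕ} {F G : (Fin n → ℝ) → ℂ} (hF : ERep k F) (hG : ERep k G) :
    ERep k (fun s => F s + G s) := by
  obtain ⟨d, Q, hQ, hQh, ι, _, p, v, hp, h⟩ := hF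
  obtain ⟨d', Q', hQ', hQh', ι', _, p', v', hp', h'⟩ := hG
  refine ⟨d + (d' + k), Q * Q', mul_ne_zero hQ hQ', ?_, ι ⊕ ι', inferInstance,
    Sum.elim (fun i => p i * Q') (fun i => Q * p' i), Sum.elim v v', ?_, ?_⟩
  · have := hQh.mul hQh'
    convert this using 1
    ring
  · rintro (i | i)
    · exact (hp i).mul hQh'
    · have := hQh.mul (hp' i)
      simp only [Sum.elim_inr]
      convert this using 1
      ring
  · intro s
    simp only [Fintype.sum_sum_type, Sum.elim_inl, Sum.elim_inr, evc_mul]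
    have e1 : ∑ i, evc (p i) s * evc Q' s * ee s (v i) =
        evc Q' s * ∑ i, evc (p i) s * ee s (v i) := by
      rw [Finset.mul_sum]; exact Finset.sum_congr rfl fun _ _ => by ring
    have e2 : ∑ i, evc Q s * evc (p' i) s * ee s (v' i) =
        evc Q s * ∑ i, evc (p' i) s * ee s (v' i) := by
      rw [Finset.mul_sum]; exact Finset.sum_congr rfl fun _ _ => by ring
    rw [e1, e2, ← h, ← h']
    ring

lemma ERep.smul {n k : ℕ} {F : (Fin n → ℝ) → ℂ} (c : ℂ) (hF : ERep k F) :
    ERep k (fun s => c * F s) := by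
  obtain ⟨d, Q, hQ, hQh, ι, _, p, v, hp, h⟩ := hF
  refine ⟨d, Q, hQ, hQh, ι, inferInstance, fun i => MvPolynomial.C c * p i, v,
    fun i => (hp i).C_mul c, fun s => ?_⟩
  have : ∑ i, evc (MvPolynomial.C c * p i) s * ee s (v i) =
      c * ∑ i, evc (p i) s * ee s (v i) := by
    rw [Finset.mul_sum]; exact Finset.sum_congr rfl fun _ _ => by simp [evc]; ring
  rw [this, ← h]; ring

lemma ERep.sub {n k : ℕ} {F G : (Fin n → ℝ) → ℂ} (hF : ERep k F) (hG : ERep k G) :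
    ERep k (fun s => F s - G s) := by
  have := hF.add (hG.smul (-1))
  convert this using 2
  ring

lemma ERep.congr {n k : ℕ} {F G : (Fin n → ℝ) → ℂ} (hF : ERep k F) (h : ∀ s, G s = F s) :
    ERep k G := by
  have : G = F := funext h
  rwa [this]

lemma ERep.div {n k : ℕ} {F G : (Fin (n+1) → ℝ) → ℂ} (hG : ERep k G)
    (h : ∀ s, (s 0 : ℂ) * F s = G s) : ERep (k+1) F := by
  obtain ⟨d, Q, hQ, hQh, ι, _, p, v, hp, h'⟩ := hG
  refine ⟨d, Q * MvPolynomial.X 0, mul_ne_zero hQ (MvPolynomial.X_ne_zero _),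
    hQh.mul (MvPolynomial.isHomogeneous_X _ _), ι, inferInstance, p, v, hp, fun s => ?_⟩
  rw [← h', ← h]
  simp [evc, mul_assoc]

/-- substitution `s ↦ s' + s₀ α` -/
noncomputable def subst {n : ℕ} (α : Fin n → ℝ) :
    MvPolynomial (Fin n) ℂ →ₐ[ℂ] MvPolynomial (Fin (n+1)) ℂ :=
  MvPolynomial.aeval (fun i => MvPolynomial.X i.succ +
    MvPolynomial.C (α i : ℂ) * MvPolynomial.X 0)

lemma evc_subst {n : ℕ} (α : Fin n → ℝ) (p : MvPolynomial (Fin n) ℂ) (s : Fin (n+1) → ℝ) :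
    evc (subst α p) s = evc p (fun i => s i.succ + s 0 * α i) := by
  simp only [evc, subst]
  rw [← MvPolynomial.coe_aeval_eq_eval, ← MvPolynomial.coe_aeval_eq_eval]
  simp only [RingHom.coe_coe]
  rw [← AlgHom.comp_apply]
  congr 1
  ext i
  simp [mul_comm]

lemma subst_ne_zero {n : ℕ} (α : Fin n → ℝ) (p : MvPolynomial (Fin n) ℂ) (hp : p ≠ 0) :
    subst α p ≠ 0 := by
  intro h
  apply hp
  have h2 := congrArg (MvPolynomial.aeval (R := ℂ)
    (Fin.cons (0 : MvPolynomial (Fin n) ℂ) (fun j => MvPolynomial.X j))) h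
  rw [subst, ← AlgHom.comp_apply, MvPolynomial.comp_aeval, map_zero] at h2
  simpa [MvPolynomial.aeval_X_left] using h2

lemma subst_hom {n d : ℕ} (α : Fin n → ℝ) (p : MvPolynomial (Fin n) ℂ) (hp : p.IsHomogeneous d) :
    (subst α p).IsHomogeneous d := by
  have := hp.aeval (n := 1) (fun i : Fin n => (MvPolynomial.X i.succ +
    MvPolynomial.C (α i : ℂ) * MvPolynomial.X 0 : MvPolynomial (Fin (n+1)) ℂ))
    (fun i => (MvPolynomial.isHomogeneous_X _ _).add (MvPolynomial.isHomogeneous_C_mul_X _ _))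
  rw [one_mul] at this
  exact this

lemma ERep.subst {n k : ℕ} {F : (Fin n → ℝ) → ℂ} (hF : ERep k F) (α : Fin n → ℝ) (β : ℝ) :
    ERep k (fun s : Fin (n+1) → ℝ => Complex.exp (-Complex.I * ((s 0 * β : ℝ) : ℂ)) *
      F (fun i => s i.succ + s 0 * α i)) := by
  obtain ⟨d, Q, hQ, hQh, ι, _, p, v, hp, h⟩ := hF
  refine ⟨d, _root_.subst α Q, subst_ne_zero _ _ hQ, subst_hom _ _ hQh, ι, inferInstance,
    fun i => _root_.subst α (p i), fun i => Fin.cons (β + α ⬝ᵥ v i) (v i),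
    fun i => subst_hom _ _ (hp i), fun s => ?_⟩
  simp only [evc_subst]
  rw [mul_left_comm, h, Finset.mul_sum]
  refine Finset.sum_congr rfl fun i _ => ?_
  rw [mul_left_comm]
  congr 1
  rw [ee, ee, ← Complex.exp_add]
  congr 1
  rw [← mul_add, ← Complex.ofReal_add]
  congr 2
  simp only [dotProduct, Fin.sum_univ_succ, Fin.cons_zero, Fin.cons_succ, add_mul,
    Finset.sum_add_distrib, mul_add, Finset.mul_sum]
  simp only [mul_assoc]
  ring

lemma exists_between_finset {ι : Type*} (S T : Finset ι) (f g : ι → ℝ)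
    (h : ∀ i ∈ S, ∀ j ∈ T, f i ≤ g j) (h0 : ∀ j ∈ T, 0 ≤ g j) :
    ∃ t : ℝ, 0 ≤ t ∧ (∀ i ∈ S, f i ≤ t) ∧ ∀ j ∈ T, t ≤ g j := by
  classical
  let W : Finset ℝ := insert 0 (S.image f)
  have hW : W.Nonempty := ⟨0, by simp [W]⟩
  refine ⟨W.max' hW, W.le_max' _ (by simp [W]), fun i hi => W.le_max' _ ?_, fun j hj => ?_⟩
  · simp only [W, Finset.mem_insert, Finset.mem_image]
    exact Or.inr ⟨i, hi, rfl⟩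
  · apply Finset.max'_le
    intro y hy
    simp only [W, Finset.mem_insert, Finset.mem_image] at hy
    rcases hy with rfl | ⟨i, hi, rfl⟩
    · exact h0 j hj
    · exact h i hi j hj

lemma weyl_cone {M : Type*} [AddCommGroup M] [Module ℝ M] [FiniteDimensional ℝ M]
    (V : Finset M) : ∃ A : Finset (Module.Dual ℝ M), ∀ z : M,
      (∃ w : M → ℝ, (∀ v ∈ V, 0 ≤ w v) ∧ ∑ v ∈ V, w v • v = z) ↔ ∀ a ∈ A, a z ≤ 0 := by
  classical
  induction V using Finset.induction_on with
  | empty =>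
    let b := Module.finBasis ℝ M
    refine ⟨(Finset.univ.image fun i => b.coord i) ∪ (Finset.univ.image fun i => -b.coord i),
      fun z => ?_⟩
    constructor
    · rintro ⟨w, -, hw⟩ a ha
      simp at hw
      simp [← hw]
    · intro h
      refine ⟨0, by simp, ?_⟩
      have : ∀ i, b.coord i z = 0 := by
        intro i
        have h1 := h (b.coord i) (by simp)
        have h2 := h (-b.coord i) (by simp)
        simp only [LinearMap.neg_apply] at h2
        linarith
      simpa using ((b.forall_coord_eq_zero_iff).1 this).symm
  | insert v V hv ih =>
    obtain ⟨A, hA⟩ := ih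
    let N := A.filter (fun a => a v ≤ 0)
    let N' := A.filter (fun a => a v < 0)
    let P := A.filter (fun a => 0 < a v)
    refine ⟨N ∪ (P ×ˢ N').image (fun ab => (ab.1 v) • ab.2 - (ab.2 v) • ab.1), fun z => ?_⟩
    have step : (∃ w : M → ℝ, (∀ u ∈ insert v V, 0 ≤ w u) ∧ ∑ u ∈ insert v V, w u • u = z) ↔
        ∃ t : ℝ, 0 ≤ t ∧ ∀ a ∈ A, a (z - t • v) ≤ 0 := by
      constructor
      · rintro ⟨w, hw, hz⟩
        refine ⟨w v, hw v (by simp), (hA _).1 ⟨w, fun u hu => hw u (by simp [hu]), ?_⟩⟩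
        rw [← hz, Finset.sum_insert hv]; abel
      · rintro ⟨t, ht, h⟩
        obtain ⟨w, hw, hz⟩ := (hA _).2 h
        refine ⟨Function.update w v t, ?_, ?_⟩
        · intro u hu
          by_cases huv : u = v
          · subst huv; simpa using ht
          · rw [Function.update_of_ne huv]
            exact hw u (by simpa [huv] using hu)
        · rw [Finset.sum_insert hv, Function.update_self]
          have : ∑ x ∈ V, Function.update w v t x • x = ∑ x ∈ V, w x • x := by
            refine Finset.sum_congr rfl fun x hx => ?_
            rw [Function.update_of_ne]
            rintro rfl; exact hv hx
          rw [this, hz]; abel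
    rw [step]
    constructor
    · rintro ⟨t, ht, h⟩ a ha
      simp only [map_sub, map_smul, smul_eq_mul] at h
      simp only [Finset.mem_union, Finset.mem_image, Finset.mem_product, N, N', P,
        Finset.mem_filter] at ha
      rcases ha with ⟨ha, hav⟩ | ⟨⟨a1, a2⟩, ⟨⟨h1, h1v⟩, h2, h2v⟩, rfl⟩
      · have := h a ha
        nlinarith
      · have e1 := h a1 h1
        have e2 := h a2 h2
        simp only [LinearMap.sub_apply, LinearMap.smul_apply, smul_eq_mul] at *
        nlinarith
    · intro h
      obtain ⟨t, ht, h1, h2⟩ := exists_between_finset P N' (fun a => a z / a v)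
        (fun a => a z / a v) (by
          intro a ha b hb
          have := h _ (Finset.mem_union_right _ (Finset.mem_image.2
            ⟨(a, b), Finset.mem_product.2 ⟨ha, hb⟩, rfl⟩))
          simp only [LinearMap.sub_apply, LinearMap.smul_apply, smul_eq_mul] at this
          have ha' := (Finset.mem_filter.1 ha).2
          have hb' := (Finset.mem_filter.1 hb).2
          rw [div_le_iff₀ ha', div_mul_eq_mul_div, le_div_iff_of_neg hb']
          nlinarith) (by
          intro b hb
          have hb' := (Finset.mem_filter.1 hb)
          have := h b (Finset.mem_union_left _ (Finset.mem_filter.2 ⟨hb'.1, hb'.2.le⟩))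
          exact div_nonneg_of_nonpos this hb'.2.le)
      refine ⟨t, ht, fun a ha => ?_⟩
      simp only [map_sub, map_smul, smul_eq_mul]
      rcases lt_trichotomy (a v) 0 with hav | hav | hav
      · have := h2 a (Finset.mem_filter.2 ⟨ha, hav⟩)
        rw [le_div_iff_of_neg hav] at this
        linarith
      · have := h a (Finset.mem_union_left _ (Finset.mem_filter.2 ⟨ha, hav.le⟩))
        rw [hav]; linarith
      · have := h1 a (Finset.mem_filter.2 ⟨ha, hav⟩)
        rw [div_le_iff₀ hav] at this
        linarith

/-- closed polyhedron -/
def HPoly {n : ℕ} (L : List ((Fin n → ℝ) × ℝ)) : Set (Fin n → ℝ) :=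
  {x | ∀ c ∈ L, c.1 ⬝ᵥ x ≤ c.2}

lemma weyl_hull {n : ℕ} (V : Finset (EuclideanSpace ℝ (Fin n))) :
    ∃ L : List ((Fin n → ℝ) × ℝ), ∀ x : EuclideanSpace ℝ (Fin n),
      x ∈ convexHull ℝ (V : Set (EuclideanSpace ℝ (Fin n))) ↔ WithLp.ofLp x ∈ HPoly L := by
  classical
  obtain ⟨A, hA⟩ := weyl_cone (V.image fun v => ((v, (1:ℝ)) : EuclideanSpace ℝ (Fin n) × ℝ))
  refine ⟨A.toList.map (fun a => (fun i => a (EuclideanSpace.single i 1, 0), -a (0, 1))),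
    fun x => ?_⟩
  have h1 : x ∈ convexHull ℝ (V : Set (EuclideanSpace ℝ (Fin n))) ↔
      ∀ a ∈ A, a (x, 1) ≤ 0 := by
    rw [← hA, Finset.mem_convexHull']
    have inj : Function.Injective (fun v => ((v, (1:ℝ)) : EuclideanSpace ℝ (Fin n) × ℝ)) := by
      intro a b h; exact (Prod.ext_iff.1 h).1
    constructor
    · rintro ⟨w, h0, h1, hx⟩
      refine ⟨fun z => w z.1, by simpa using h0, ?_⟩
      rw [Finset.sum_image inj.injOn]
      simp only [Prod.smul_mk, smul_eq_mul, mul_one]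
      rw [Prod.ext_iff, Prod.fst_sum, Prod.snd_sum]
      exact ⟨hx, h1⟩
    · rintro ⟨w, h0, hx⟩
      rw [Finset.sum_image inj.injOn] at hx
      simp only [Prod.smul_mk, smul_eq_mul, mul_one] at hx
      rw [Prod.ext_iff, Prod.fst_sum, Prod.snd_sum] at hx
      exact ⟨fun z => w (z, 1), fun y hy => h0 _ (Finset.mem_image_of_mem _ hy), hx.2, hx.1⟩
  rw [h1]
  have h2 : ∀ a : Module.Dual ℝ (EuclideanSpace ℝ (Fin n) × ℝ), a (x, 1) =
      (fun i => a (EuclideanSpace.single i 1, 0)) ⬝ᵥ WithLp.ofLp x + a (0, 1) := by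
    intro a
    have e : x = ∑ i, x i • EuclideanSpace.single i (1:ℝ) := by
      ext j
      simp [Finset.sum_apply, Pi.single_apply]
    have e2 : ((x, 1) : EuclideanSpace ℝ (Fin n) × ℝ) =
        ∑ i, x i • (EuclideanSpace.single i (1:ℝ), (0:ℝ)) + (0, 1) := by
      rw [Prod.ext_iff, Prod.fst_add, Prod.snd_add, Prod.fst_sum, Prod.snd_sum]
      simp only [Prod.smul_mk]
      rw [← e]; simp
    rw [e2, map_add, map_sum]
    simp only [map_smul, dotProduct, smul_eq_mul]
    simp only [mul_comm]
  simp only [HPoly, Set.mem_ofPred_eq, List.mem_map, Finset.mem_toList]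
  constructor
  · rintro h c ⟨a, ha, rfl⟩
    have := h a ha
    rw [h2] at this
    simp only
    linarith
  · intro h a ha
    have := h _ ⟨a, ha, rfl⟩
    rw [h2]
    simp only at this
    linarith

open Polynomial in
lemma logder_coprime (a b g h : ℂ[X]) (c : ℂ) (hc : c ≠ 0) (ha : a ≠ 0) (hb : b ≠ 0) (hh : h ≠ 0)
    (hco : IsCoprime g h)
    (H : h ^ 2 * (b * derivative a - a * derivative b) =
      C c * a * b * (derivative g * h - g * derivative h)) :
    ∃ κ : ℂ, g = C κ * h := by
  have hnoroot : ∀ z, ¬ h.IsRoot z := by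
    intro z hz
    obtain ⟨a1, ha1, ha1z⟩ := Polynomial.exists_eq_pow_rootMultiplicity_mul_and_not_dvd a ha z
    obtain ⟨b1, hb1, hb1z⟩ := Polynomial.exists_eq_pow_rootMultiplicity_mul_and_not_dvd b hb z
    obtain ⟨h1, hh1, hh1z⟩ := Polynomial.exists_eq_pow_rootMultiplicity_mul_and_not_dvd h hh z
    have hk : 0 < h.rootMultiplicity z := (Polynomial.rootMultiplicity_pos hh).2 hz
    have hgz : g.eval z ≠ 0 := by
      intro hg
      obtain ⟨u, v, huv⟩ := hco
      have := congrArg (Polynomial.eval z) huv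
      simp [hg, hz.eq_zero] at this
    generalize h.rootMultiplicity z = k at *
    generalize a.rootMultiplicity z = α at *
    generalize b.rootMultiplicity z = β at *
    rw [Polynomial.dvd_iff_isRoot, Polynomial.IsRoot.def] at ha1z hb1z hh1z
    have key : ∀ (k : ℕ) (p p1 : ℂ[X]), p = (X - C z) ^ k * p1 →
        (X - C z) * derivative p =
          (X - C z) ^ k * (C (k : ℂ) * p1 + (X - C z) * derivative p1) := by
      intro k p p1 hp
      rw [hp, derivative_mul, derivative_pow]
      rcases k with _ | k
      · simp
      · simp only [Nat.add_sub_cancel, derivative_sub, derivative_X, derivative_C]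
        ring
    have ka := key _ _ _ ha1
    have kb := key _ _ _ hb1
    have kh := key _ _ _ hh1
    set Y := X - C z with hY
    have hY0 : Y ≠ 0 := X_sub_C_ne_zero z
    have H2 : Y ^ (α + β + k) * (Y ^ k * h1 ^ 2 *
        (b1 * (C (α:ℂ) * a1 + Y * derivative a1) - a1 * (C (β:ℂ) * b1 + Y * derivative b1))) =
        Y ^ (α + β + k) * (C c * a1 * b1 *
          (Y * derivative g * h1 - g * (C (k:ℂ) * h1 + Y * derivative h1))) := by
      have := congrArg (fun p => Y * p) H
      have l : Y * (h ^ 2 * (b * derivative a - a * derivative b)) =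
          h ^ 2 * (b * (Y * derivative a) - a * (Y * derivative b)) := by ring
      have r : Y * (C c * a * b * (derivative g * h - g * derivative h)) =
          C c * a * b * (Y * derivative g * h - g * (Y * derivative h)) := by ring
      rw [l, r, ka, kb, kh, ha1, hb1, hh1] at this
      linear_combination this
    have H3 := mul_left_cancel₀ (pow_ne_zero _ hY0) H2
    have H4 := congrArg (Polynomial.eval z) H3
    have hYz : Y.eval z = 0 := by simp [hY]
    simp only [eval_mul, eval_pow, eval_sub, eval_add, hYz, zero_pow hk.ne', eval_C, zero_mul,
      add_zero, zero_sub] at H4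
    have hk' : (k : ℂ) ≠ 0 := by exact_mod_cast hk.ne'
    have := H4.symm
    simp only [mul_eq_zero, neg_eq_zero] at this
    tauto
  have hdeg : h.degree = 0 := by
    by_contra hd
    obtain ⟨z, hz⟩ := Complex.exists_root (f := h) (by
      rcases lt_or_ge 0 h.degree with h' | h'
      · exact h'
      · exact absurd (le_antisymm h' (by
          rw [Polynomial.degree_eq_natDegree hh]; exact_mod_cast Nat.zero_le _)) hd)
    exact hnoroot z hz
  obtain ⟨e, he⟩ : ∃ e, h = C e := ⟨_, Polynomial.eq_C_of_degree_eq_zero hdeg⟩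
  have he0 : e ≠ 0 := by rintro rfl; simp at he; exact hh he
  subst he
  simp only [derivative_C, mul_zero, sub_zero] at H
  by_cases hg' : derivative g = 0
  · refine ⟨g.coeff 0 / e, ?_⟩
    rw [← C_mul, div_mul_cancel₀ _ he0]
    exact Polynomial.eq_C_of_derivative_eq_zero hg'
  · exfalso
    have H2 : C e * (b * derivative a - a * derivative b) = C c * a * b * derivative g := by
      apply mul_left_cancel₀ (C_ne_zero.2 he0)
      linear_combination H
    have hab : a * b ≠ 0 := mul_ne_zero ha hb
    have d1 : (C c * a * b * derivative g).degree = (a * b).degree + (derivative g).degree := by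
      rw [mul_assoc (C c), degree_mul, degree_C_mul hc]
    have d2 : (C e * (b * derivative a - a * derivative b)).degree < (a * b).degree := by
      rw [degree_C_mul he0]
      refine lt_of_le_of_lt (degree_sub_le _ _) (max_lt ?_ ?_)
      · rw [degree_mul, degree_mul, add_comm a.degree]
        exact WithBot.add_lt_add_left (degree_ne_bot.2 hb) (degree_derivative_lt ha)
      · rw [degree_mul, degree_mul]
        exact WithBot.add_lt_add_left (degree_ne_bot.2 ha) (degree_derivative_lt hb)
    rw [H2, d1] at d2
    have : (0 : WithBot ℕ) ≤ (derivative g).degree := by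
      rw [degree_eq_natDegree hg']; exact_mod_cast Nat.zero_le _
    exact absurd d2 (not_lt.2 (le_add_of_nonneg_right this))

open Polynomial in
lemma logder (a b g h : ℂ[X]) (c : ℂ) (hc : c ≠ 0) (ha : a ≠ 0) (hb : b ≠ 0) (hh : h ≠ 0)
    (H : h ^ 2 * (b * derivative a - a * derivative b) =
      C c * a * b * (derivative g * h - g * derivative h)) :
    ∃ κ : ℂ, g = C κ * h := by
  classical
  obtain ⟨g1, hg1⟩ := EuclideanDomain.gcd_dvd_left g h
  obtain ⟨h1, hh1⟩ := EuclideanDomain.gcd_dvd_right g h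
  have hd0 : EuclideanDomain.gcd g h ≠ 0 := by
    intro h0; rw [h0, zero_mul] at hh1; exact hh hh1
  have hbez := EuclideanDomain.gcd_eq_gcd_ab g h
  set d := EuclideanDomain.gcd g h
  set u := EuclideanDomain.gcdA g h
  set v := EuclideanDomain.gcdB g h
  have hco : IsCoprime g1 h1 := by
    refine ⟨u, v, mul_left_cancel₀ hd0 ?_⟩
    rw [mul_one]
    conv_rhs => rw [hbez]
    conv_rhs => rw [hg1, hh1]
    ring
  have hh10 : h1 ≠ 0 := by rintro rfl; rw [mul_zero] at hh1; exact hh hh1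
  obtain ⟨κ, hκ⟩ := logder_coprime a b g1 h1 c hc ha hb hh10 hco (by
    apply mul_left_cancel₀ (pow_ne_zero 2 hd0)
    rw [hg1, hh1] at H
    simp only [derivative_mul] at H
    linear_combination H)
  exact ⟨κ, by rw [hg1, hh1, hκ]; ring⟩

open Polynomial in
lemma poly_zero_of_open (p : ℂ[X]) (U : Set ℝ) (hU : IsOpen U) (hne : U.Nonempty)
    (h : ∀ t ∈ U, p.eval (t : ℂ) = 0) : p = 0 := by
  apply Polynomial.eq_zero_of_infinite_isRoot
  have : (((↑) : ℝ → ℂ) '' U).Infinite := by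
    apply Set.Infinite.image Complex.ofReal_injective.injOn
    obtain ⟨x, hx⟩ := hne
    exact infinite_of_mem_nhds x (hU.mem_nhds hx)
  refine this.mono ?_
  rintro _ ⟨t, ht, rfl⟩
  exact h t ht

open Polynomial in
lemma exp_indep {ι : Type*} (S : Finset ι) (h : ℂ[X]) (g : ι → ℂ[X]) (U : Set ℝ) (hU : IsOpen U)
    (hne : U.Nonempty) (hh : ∀ t ∈ U, h.eval (t : ℂ) ≠ 0)
    (hg : ∀ i ∈ S, ∀ j ∈ S, i ≠ j → ¬ ∃ κ : ℂ, g i - g j = C κ * h) (r : ι → ℂ[X])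
    (H : ∀ t ∈ U, ∑ i ∈ S, (r i).eval (t : ℂ) *
      Complex.exp (-Complex.I * ((g i).eval (t:ℂ) / h.eval (t:ℂ))) = 0) :
    ∀ i ∈ S, r i = 0 := by
  classical
  have hh0 : h ≠ 0 := by
    rintro rfl
    obtain ⟨x, hx⟩ := hne
    exact hh x hx (by simp)
  induction S using Finset.induction_on generalizing r with
  | empty => simp
  | insert w S hw ih =>
    let D : ι → ℂ[X] := fun i => h ^ 2 * derivative (r i) +
      C (-Complex.I) * (r i) * (derivative (g i) * h - g i * derivative h)
    -- derivative
    have hD : ∀ t ∈ U, ∑ i ∈ insert w S, (D i).eval (t : ℂ) *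
      Complex.exp (-Complex.I * ((g i).eval (t:ℂ) / h.eval (t:ℂ))) = 0 := by
      intro t ht
      have hd : HasDerivAt (fun t : ℝ => ∑ i ∈ insert w S, (r i).eval (t : ℂ) *
          Complex.exp (-Complex.I * ((g i).eval (t:ℂ) / h.eval (t:ℂ))))
          (∑ i ∈ insert w S, ((derivative (r i)).eval (t:ℂ) *
            Complex.exp (-Complex.I * ((g i).eval (t:ℂ) / h.eval (t:ℂ))) +
            (r i).eval (t:ℂ) * (Complex.exp (-Complex.I * ((g i).eval (t:ℂ) / h.eval (t:ℂ))) *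
              (-Complex.I * (((derivative (g i)).eval (t:ℂ) * h.eval (t:ℂ) -
                (g i).eval (t:ℂ) * (derivative h).eval (t:ℂ)) / (h.eval (t:ℂ)) ^ 2))))) t := by
        apply HasDerivAt.fun_sum
        intro i _
        have p1 : ∀ q : ℂ[X], HasDerivAt (fun t : ℝ => q.eval (t:ℂ))
            ((derivative q).eval (t:ℂ)) t := fun q =>
          (q.hasDerivAt (t:ℂ)).comp_ofReal
        exact (p1 _).mul ((((p1 (g i)).div (p1 h) (hh t ht)).const_mul (-Complex.I)).cexp)
      have hz : HasDerivAt (fun t : ℝ => ∑ i ∈ insert w S, (r i).eval (t : ℂ) *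
          Complex.exp (-Complex.I * ((g i).eval (t:ℂ) / h.eval (t:ℂ)))) 0 t := by
        refine (hasDerivAt_const t (0:ℂ)).congr_of_eventuallyEq ?_
        filter_upwards [hU.mem_nhds ht] with s hs using H s hs
      have e := hd.unique hz
      have e2 := congrArg (fun z => (h.eval (t:ℂ)) ^ 2 * z) e
      simp only [mul_zero, Finset.mul_sum] at e2
      rw [← e2]
      refine Finset.sum_congr rfl fun i _ => ?_
      have := hh t ht
      simp only [D, eval_add, eval_mul, eval_pow, eval_C, eval_sub]
      field_simp
    have hrel : ∀ i ∈ S, r w * D i - D w * r i = 0 := by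
      apply ih (fun i hi j hj hij => hg i (Finset.mem_insert_of_mem hi) j
        (Finset.mem_insert_of_mem hj) hij)
      intro t ht
      have e1 := hD t ht
      have e2 := H t ht
      have e3 : ∑ i ∈ insert w S, (r w * D i - D w * r i).eval (t:ℂ) *
          Complex.exp (-Complex.I * ((g i).eval (t:ℂ) / h.eval (t:ℂ))) = 0 := by
        have : ∑ i ∈ insert w S, (r w * D i - D w * r i).eval (t:ℂ) *
          Complex.exp (-Complex.I * ((g i).eval (t:ℂ) / h.eval (t:ℂ))) =
          (r w).eval (t:ℂ) * ∑ i ∈ insert w S, (D i).eval (t : ℂ) *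
            Complex.exp (-Complex.I * ((g i).eval (t:ℂ) / h.eval (t:ℂ))) -
          (D w).eval (t:ℂ) * ∑ i ∈ insert w S, (r i).eval (t : ℂ) *
            Complex.exp (-Complex.I * ((g i).eval (t:ℂ) / h.eval (t:ℂ))) := by
          rw [Finset.mul_sum, Finset.mul_sum, ← Finset.sum_sub_distrib]
          refine Finset.sum_congr rfl fun i _ => ?_
          simp only [eval_sub, eval_mul]
          ring
        rw [this, e1, e2]; ring
      rw [Finset.sum_insert hw] at e3
      have : r w * D w - D w * r w = 0 := by ring
      rw [this] at e3
      simpa using e3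
    have hS : r w = 0 ∨ ∀ i ∈ S, r i = 0 := by
      by_cases hrw : r w = 0
      · exact Or.inl hrw
      · refine Or.inr fun i hi => ?_
        by_contra hri
        refine hg i (Finset.mem_insert_of_mem hi) w (Finset.mem_insert_self _ _)
          (by rintro rfl; exact hw hi) ?_
        apply logder (r i) (r w) (g i - g w) h Complex.I Complex.I_ne_zero hri hrw hh0
        have := hrel i hi
        simp only [D] at this
        have hI : (C (-Complex.I) : ℂ[X]) = - C Complex.I := by simp
        rw [hI] at this
        simp only [derivative_sub]
        linear_combination this
    rcases hS with hrw | hS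
    · have := ih (fun i hi j hj hij => hg i (Finset.mem_insert_of_mem hi) j
        (Finset.mem_insert_of_mem hj) hij) r (by
          intro t ht
          have := H t ht
          rw [Finset.sum_insert hw, hrw] at this
          simpa using this)
      intro i hi
      rcases Finset.mem_insert.1 hi with rfl | hi
      · exact hrw
      · exact this i hi
    · have hrw : r w = 0 := by
        apply poly_zero_of_open _ U hU hne
        intro t ht
        have := H t ht
        rw [Finset.sum_insert hw, Finset.sum_eq_zero (fun i hi => by rw [hS i hi]; simp),
          add_zero] at this
        exact (mul_eq_zero.1 this).resolve_right (Complex.exp_ne_zero _)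
      intro i hi
      rcases Finset.mem_insert.1 hi with rfl | hi
      · exact hrw
      · exact hS i hi

section
open MeasureTheory

noncomputable def FT {n : ℕ} (P : Set (Fin n → ℝ)) (s : Fin n → ℝ) : ℂ := ∫ x in P, ee s x

lemma continuous_ee {n : ℕ} (s : Fin n → ℝ) : Continuous (ee s) := by
  unfold ee dotProduct
  fun_prop

lemma integrableOn_ee {n : ℕ} (P : Set (Fin n → ℝ)) (hb : Bornology.IsBounded P)
    (s : Fin n → ℝ) : IntegrableOn (ee s) P := by
  obtain ⟨R, hR⟩ := hb.subset_closedBall 0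
  exact ((continuous_ee s).continuousOn.integrableOn_compact
    (isCompact_closedBall 0 R)).mono_set hR

lemma FT_split {n : ℕ} (P A B : Set (Fin n → ℝ)) (hb : Bornology.IsBounded P)
    (hA : MeasurableSet A) (h : P ⊆ A ∪ B)
    (s : Fin n → ℝ) : FT P s = FT (P ∩ A) s + FT (P ∩ B) s - FT (P ∩ B ∩ A) s := by
  have h1 := integral_inter_add_sdiff (μ := volume) hA (integrableOn_ee P hb s)
  have h2 := integral_inter_add_sdiff (μ := volume) hA
    (integrableOn_ee (P ∩ B) (hb.subset Set.inter_subset_left) s)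
  have h3 : (P ∩ B) \ A = P \ A := by
    ext x
    simp only [Set.mem_sdiff, Set.mem_inter_iff]
    constructor
    · tauto
    · intro hx
      have := h hx.1
      simp only [Set.mem_union] at this
      tauto
  rw [h3] at h2
  unfold FT
  rw [← h1, ← h2]
  ring

lemma isClosed_HPoly {n : ℕ} (L : List ((Fin n → ℝ) × ℝ)) : IsClosed (HPoly L) := by
  have : HPoly L = ⋂ c ∈ L, {x | c.1 ⬝ᵥ x ≤ c.2} := by
    ext x; simp [HPoly]
  rw [this]
  refine isClosed_iInter fun c => isClosed_iInter fun _ => ?_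
  apply isClosed_le _ continuous_const
  unfold dotProduct
  fun_prop

lemma mem_HPoly_cons {n : ℕ} (c) (L : List ((Fin n → ℝ) × ℝ)) (x : Fin n → ℝ) :
    x ∈ HPoly (c :: L) ↔ c.1 ⬝ᵥ x ≤ c.2 ∧ x ∈ HPoly L := by
  simp [HPoly]

lemma mem_HPoly_append {n : ℕ} (L L' : List ((Fin n → ℝ) × ℝ)) (x : Fin n → ℝ) :
    x ∈ HPoly (L ++ L') ↔ x ∈ HPoly L ∧ x ∈ HPoly L' := by
  simp only [HPoly, List.mem_append, Set.mem_ofPred_eq]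
  constructor
  · intro h; exact ⟨fun c hc => h c (Or.inl hc), fun c hc => h c (Or.inr hc)⟩
  · rintro ⟨h1, h2⟩ c (hc | hc)
    · exact h1 c hc
    · exact h2 c hc

def aff {n : ℕ} (c : (Fin n → ℝ) × ℝ) (x : Fin n → ℝ) : ℝ := c.1 ⬝ᵥ x + c.2

lemma continuous_aff {n : ℕ} (c : (Fin n → ℝ) × ℝ) : Continuous (aff c) := by
  unfold aff dotProduct
  fun_prop

def leC {n : ℕ} (c d : (Fin n → ℝ) × ℝ) : (Fin n → ℝ) × ℝ := (c.1 - d.1, d.2 - c.2)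

lemma leC_iff {n : ℕ} (c d : (Fin n → ℝ) × ℝ) (x : Fin n → ℝ) :
    (leC c d).1 ⬝ᵥ x ≤ (leC c d).2 ↔ aff c x ≤ aff d x := by
  simp only [leC, aff, sub_dotProduct]
  constructor <;> intro h <;> linarith

def TT {n : ℕ} (L : List ((Fin n → ℝ) × ℝ)) (l u : (Fin n → ℝ) × ℝ) : Set (Fin (n+1) → ℝ) :=
  {x | Fin.tail x ∈ HPoly L ∧ aff l (Fin.tail x) ≤ x 0 ∧ x 0 ≤ aff u (Fin.tail x)}

lemma continuous_tail {n : ℕ} : Continuous (fun x : Fin (n+1) → ℝ => Fin.tail x) := by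
  unfold Fin.tail; fun_prop

lemma isClosed_TT {n : ℕ} (L : List ((Fin n → ℝ) × ℝ)) (l u : (Fin n → ℝ) × ℝ) :
    IsClosed (TT L l u) := by
  have c := continuous_tail (n := n)
  have : TT L l u = (fun x : Fin (n+1) → ℝ => Fin.tail x) ⁻¹' HPoly L ∩
    ({x | aff l (Fin.tail x) ≤ x 0} ∩ {x | x 0 ≤ aff u (Fin.tail x)}) := by
    ext x; simp [TT]
  rw [this]
  refine ((isClosed_HPoly L).preimage c).inter ((isClosed_le ?_ ?_).inter (isClosed_le ?_ ?_))
  · exact (continuous_aff l).comp c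
  · fun_prop
  · fun_prop
  · exact (continuous_aff u).comp c

lemma integral_exp_Icc (s l u : ℝ) (h : l ≤ u) :
    (s : ℂ) * ∫ x in Set.Icc l u, Complex.exp (-Complex.I * ((s * x : ℝ) : ℂ)) =
      Complex.I * Complex.exp (-Complex.I * ((s * u : ℝ) : ℂ)) -
      Complex.I * Complex.exp (-Complex.I * ((s * l : ℝ) : ℂ)) := by
  rw [integral_Icc_eq_integral_Ioc, ← intervalIntegral.integral_of_le h]
  by_cases hs : s = 0
  · simp [hs]
  · have hs' : (s : ℂ) ≠ 0 := by exact_mod_cast hs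
    have := integral_exp_mul_complex (a := l) (b := u) (c := -Complex.I * s)
      (mul_ne_zero (neg_ne_zero.2 Complex.I_ne_zero) hs')
    push_cast
    simp only [← mul_assoc]
    rw [this]
    generalize Complex.exp (-Complex.I * s * u) = A
    generalize Complex.exp (-Complex.I * s * l) = B
    have hI := Complex.I_ne_zero
    field_simp
    linear_combination (B - A) * Complex.I_sq

lemma ee_cons {n : ℕ} (s : Fin (n+1) → ℝ) (x0 : ℝ) (x : Fin n → ℝ) :
    ee s (Fin.cons x0 x) =
      ee (Fin.tail s) x * Complex.exp (-Complex.I * ((s 0 * x0 : ℝ) : ℂ)) := by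
  rw [ee, ee, ← Complex.exp_add]
  congr 1
  rw [← mul_add, ← Complex.ofReal_add]
  congr 2
  simp only [dotProduct, Fin.sum_univ_succ, Fin.cons_zero, Fin.cons_succ, Fin.tail]
  ring

lemma ee_aff {n : ℕ} (s : Fin (n+1) → ℝ) (c : (Fin n → ℝ) × ℝ) (x : Fin n → ℝ) :
    ee (Fin.tail s) x * Complex.exp (-Complex.I * ((s 0 * aff c x : ℝ) : ℂ)) =
      Complex.exp (-Complex.I * ((s 0 * c.2 : ℝ) : ℂ)) *
        ee (fun i => s i.succ + s 0 * c.1 i) x := by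
  rw [ee, ee, ← Complex.exp_add, ← Complex.exp_add]
  congr 1
  rw [← mul_add, ← Complex.ofReal_add, ← mul_add, ← Complex.ofReal_add]
  congr 2
  simp only [aff, dotProduct, Fin.tail, add_mul, Finset.sum_add_distrib, mul_add, Finset.mul_sum]
  simp only [mul_assoc]
  ring

lemma FT_TT {n : ℕ} (L : List ((Fin n → ℝ) × ℝ)) (l u : (Fin n → ℝ) × ℝ)
    (hb : Bornology.IsBounded (TT L l u)) (hb' : Bornology.IsBounded (HPoly (leC l u :: L)))
    (s : Fin (n+1) → ℝ) :
    (s 0 : ℂ) * FT (TT L l u) s =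
      Complex.I * (Complex.exp (-Complex.I * ((s 0 * u.2 : ℝ) : ℂ)) *
        FT (HPoly (leC l u :: L)) (fun i => s i.succ + s 0 * u.1 i)) -
      Complex.I * (Complex.exp (-Complex.I * ((s 0 * l.2 : ℝ) : ℂ)) *
        FT (HPoly (leC l u :: L)) (fun i => s i.succ + s 0 * l.1 i)) := by
  have hm := (isClosed_TT L l u).measurableSet
  have hm' := (isClosed_HPoly (leC l u :: L)).measurableSet
  have hint : Integrable ((TT L l u).indicator (ee s)) :=
    (integrable_indicator_iff hm).2 (integrableOn_ee _ hb s)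
  have mp := (volume_preserving_piFinSuccAbove (fun _ : Fin (n+1) => ℝ) 0).symm
  have hcons : ∀ z : ℝ × (Fin n → ℝ),
      (MeasurableEquiv.piFinSuccAbove (fun _ : Fin (n+1) => ℝ) 0).symm z = Fin.cons z.1 z.2 := by
    intro z
    simp [MeasurableEquiv.piFinSuccAbove_symm_apply, Fin.insertNthEquiv]
  have hint2 := (mp.integrable_comp_emb (MeasurableEquiv.measurableEmbedding _)).2 hint
  have e1 : FT (TT L l u) s = ∫ x' : Fin n → ℝ, ∫ x0 : ℝ,
      (TT L l u).indicator (ee s) (Fin.cons x0 x') := by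
    rw [FT, ← integral_indicator hm, ← mp.integral_comp']
    rw [Measure.volume_eq_prod] at hint2 ⊢
    have := integral_prod_symm _ hint2
    simp only [hcons, Function.comp_def] at this ⊢
    exact this
  rw [e1, ← integral_const_mul]
  have key : ∀ x' : Fin n → ℝ, (s 0 : ℂ) * ∫ x0 : ℝ,
      (TT L l u).indicator (ee s) (Fin.cons x0 x') =
      (HPoly (leC l u :: L)).indicator (fun x' =>
        Complex.I * Complex.exp (-Complex.I * ((s 0 * u.2 : ℝ) : ℂ)) *
          ee (fun i => s i.succ + s 0 * u.1 i) x' -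
        Complex.I * Complex.exp (-Complex.I * ((s 0 * l.2 : ℝ) : ℂ)) *
          ee (fun i => s i.succ + s 0 * l.1 i) x') x' := by
    intro x'
    by_cases hx : x' ∈ HPoly (leC l u :: L)
    · rw [Set.indicator_of_mem hx]
      rw [mem_HPoly_cons, leC_iff] at hx
      have : ∀ x0 : ℝ, (TT L l u).indicator (ee s) (Fin.cons x0 x') =
          (Set.Icc (aff l x') (aff u x')).indicator (fun x0 => ee (Fin.tail s) x' *
            Complex.exp (-Complex.I * ((s 0 * x0 : ℝ) : ℂ))) x0 := by
        intro x0
        by_cases h0 : x0 ∈ Set.Icc (aff l x') (aff u x')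
        · rw [Set.indicator_of_mem h0, Set.indicator_of_mem, ee_cons]
          exact ⟨by simpa using hx.2, by simpa using h0.1, by simpa using h0.2⟩
        · rw [Set.indicator_of_notMem h0, Set.indicator_of_notMem]
          rintro ⟨-, h1, h2⟩
          exact h0 ⟨by simpa using h1, by simpa using h2⟩
      simp_rw [this]
      rw [integral_indicator measurableSet_Icc, integral_const_mul, mul_left_comm,
        integral_exp_Icc _ _ _ hx.1]
      linear_combination Complex.I * ee_aff s u x' - Complex.I * ee_aff s l x'
    · rw [Set.indicator_of_notMem hx]
      have : ∀ x0 : ℝ, (TT L l u).indicator (ee s) (Fin.cons x0 x') = 0 := by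
        intro x0
        apply Set.indicator_of_notMem
        rintro ⟨h0, h1, h2⟩
        apply hx
        rw [mem_HPoly_cons, leC_iff]
        simp only [Fin.tail_cons, Fin.cons_zero] at h0 h1 h2
        exact ⟨h1.trans h2, h0⟩
      simp [this]
  simp_rw [key]
  rw [integral_indicator hm', integral_sub, integral_const_mul, integral_const_mul]
  · unfold FT; ring
  · exact (integrableOn_ee _ hb' _).const_mul _
  · exact (integrableOn_ee _ hb' _).const_mul _

lemma base_step {n : ℕ} (IH : ∀ L : List ((Fin n → ℝ) × ℝ), Bornology.IsBounded (HPoly L) →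
    ERep n (FT (HPoly L))) (L : List ((Fin n → ℝ) × ℝ)) (l u : (Fin n → ℝ) × ℝ)
    (hb : Bornology.IsBounded (TT L l u)) : ERep (n+1) (FT (TT L l u)) := by
  have hb' : Bornology.IsBounded (HPoly (leC l u :: L)) := by
    obtain ⟨R, hR⟩ := isBounded_iff_forall_norm_le.1 hb
    refine isBounded_iff_forall_norm_le.2 ⟨R, fun x hx => ?_⟩
    rw [mem_HPoly_cons, leC_iff] at hx
    have h1 := hR (Fin.cons (aff l x) x) ⟨by simpa using hx.2, by simp, by simpa using hx.1⟩
    have hR0 : 0 ≤ R := (norm_nonneg _).trans h1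
    rw [pi_norm_le_iff_of_nonneg hR0] at h1 ⊢
    intro i
    simpa using h1 i.succ
  have h := IH _ hb'
  exact (((h.subst u.1 u.2).smul Complex.I).sub ((h.subst l.1 l.2).smul Complex.I)).div
    (fun s => FT_TT L l u hb hb' s)

lemma main_step {n : ℕ} (IH : ∀ L : List ((Fin n → ℝ) × ℝ), Bornology.IsBounded (HPoly L) →
    ERep n (FT (HPoly L))) (M : List ((Fin (n+1) → ℝ) × ℝ)) :
    ∀ (L : List ((Fin n → ℝ) × ℝ)) (l u : (Fin n → ℝ) × ℝ),
    Bornology.IsBounded (TT L l u ∩ HPoly M) → ERep (n+1) (FT (TT L l u ∩ HPoly M)) := by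
  induction M with
  | nil =>
    intro L l u hb
    have : TT L l u ∩ HPoly [] = TT L l u := by ext x; simp [HPoly]
    rw [this] at hb ⊢
    exact base_step IH L l u hb
  | cons c M ih =>
    intro L l u hb
    obtain ⟨a, b⟩ := c
    have hdot : ∀ x : Fin (n+1) → ℝ, a ⬝ᵥ x = a 0 * x 0 + Fin.tail a ⬝ᵥ Fin.tail x := by
      intro x
      simp [dotProduct, Fin.sum_univ_succ, Fin.tail]
    set γ : (Fin n → ℝ) × ℝ := (-(1 / a 0) • Fin.tail a, b / a 0) with hγ
    have haff : ∀ x : Fin (n+1) → ℝ, a 0 ≠ 0 →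
        a 0 * aff γ (Fin.tail x) = b - Fin.tail a ⬝ᵥ Fin.tail x := by
      intro x h0
      simp only [aff, hγ, smul_dotProduct, smul_eq_mul]
      field_simp
      ring
    have fin : ∀ (A B : Set (Fin (n+1) → ℝ)), MeasurableSet A → (∀ x, x ∈ A ∪ B) →
        ∀ (L1 L2 L3 : List ((Fin n → ℝ) × ℝ)) (l1 l2 l3 u1 u2 u3),
        (TT L l u ∩ HPoly ((a,b)::M)) ∩ A = TT L1 l1 u1 ∩ HPoly M →
        (TT L l u ∩ HPoly ((a,b)::M)) ∩ B = TT L2 l2 u2 ∩ HPoly M →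
        (TT L l u ∩ HPoly ((a,b)::M)) ∩ B ∩ A = TT L3 l3 u3 ∩ HPoly M →
        ERep (n+1) (FT (TT L l u ∩ HPoly ((a,b) :: M))) := by
      intro A B hA hAB L1 L2 L3 l1 l2 l3 u1 u2 u3 h1 h2 h3
      refine (((ih L1 l1 u1 ?_).add (ih L2 l2 u2 ?_)).sub (ih L3 l3 u3 ?_)).congr fun s => ?_
      · rw [← h1]; exact hb.subset Set.inter_subset_left
      · rw [← h2]; exact hb.subset Set.inter_subset_left
      · rw [← h3, Set.inter_assoc]; exact hb.subset Set.inter_subset_left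
      · rw [← h1, ← h2, ← h3]
        exact FT_split _ A B hb hA (fun x _ => hAB x) s
    have hmeas : ∀ p q : (Fin n → ℝ) × ℝ,
        MeasurableSet {x : Fin (n+1) → ℝ | aff p (Fin.tail x) ≤ aff q (Fin.tail x)} := by
      intro p q
      exact (isClosed_le ((continuous_aff p).comp continuous_tail)
        ((continuous_aff q).comp continuous_tail)).measurableSet
    rcases lt_trichotomy (a 0) 0 with h0 | h0 | h0
    · have hc : ∀ x : Fin (n+1) → ℝ, a ⬝ᵥ x ≤ b ↔ aff γ (Fin.tail x) ≤ x 0 := by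
        intro x
        have := haff x h0.ne
        rw [hdot]
        constructor <;> intro h <;> nlinarith
      refine fin {x | aff l (Fin.tail x) ≤ aff γ (Fin.tail x)}
        {x | aff γ (Fin.tail x) ≤ aff l (Fin.tail x)} (hmeas _ _) (fun x => by simpa using le_total _ _)
        (leC l γ :: L) (leC γ l :: L) (leC l γ :: leC γ l :: L) γ l l u u u ?_ ?_ ?_ <;>
      · ext x
        simp only [Set.mem_inter_iff, TT, Set.mem_ofPred_eq, mem_HPoly_cons, leC_iff, hc]
        generalize aff l (Fin.tail x) = y1
        generalize aff u (Fin.tail x) = y2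
        generalize aff γ (Fin.tail x) = y3
        generalize x 0 = y4
        generalize (x ∈ HPoly M) = p
        generalize (Fin.tail x ∈ HPoly L) = q
        clear * -
        grind
    · have : TT L l u ∩ HPoly ((a, b) :: M) = TT ((Fin.tail a, b) :: L) l u ∩ HPoly M := by
        ext x
        simp only [Set.mem_inter_iff, TT, Set.mem_ofPred_eq, mem_HPoly_cons, hdot, h0, zero_mul,
          zero_add]
        tauto
      rw [this] at hb ⊢
      exact ih _ _ _ hb
    · have hc : ∀ x : Fin (n+1) → ℝ, a ⬝ᵥ x ≤ b ↔ x 0 ≤ aff γ (Fin.tail x) := by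
        intro x
        have := haff x h0.ne'
        rw [hdot]
        constructor <;> intro h <;> nlinarith
      refine fin {x | aff γ (Fin.tail x) ≤ aff u (Fin.tail x)}
        {x | aff u (Fin.tail x) ≤ aff γ (Fin.tail x)} (hmeas _ _) (fun x => by simpa using le_total _ _)
        (leC γ u :: L) (leC u γ :: L) (leC γ u :: leC u γ :: L) l l l γ u u ?_ ?_ ?_ <;>
      · ext x
        simp only [Set.mem_inter_iff, TT, Set.mem_ofPred_eq, mem_HPoly_cons, leC_iff, hc]
        generalize aff l (Fin.tail x) = y1
        generalize aff u (Fin.tail x) = y2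
        generalize aff γ (Fin.tail x) = y3
        generalize x 0 = y4
        generalize (x ∈ HPoly M) = p
        generalize (Fin.tail x ∈ HPoly L) = q
        clear * -
        grind

lemma ERep_HPoly {n : ℕ} : ∀ (L : List ((Fin n → ℝ) × ℝ)), Bornology.IsBounded (HPoly L) →
    ERep n (FT (HPoly L)) := by
  induction n with
  | zero =>
    intro L _
    refine ⟨0, 1, one_ne_zero, MvPolynomial.isHomogeneous_one _ _, Unit, inferInstance,
      fun _ => MvPolynomial.C (FT (HPoly L) 0), fun _ => 0,
      fun _ => MvPolynomial.isHomogeneous_C _ _, fun s => ?_⟩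
    have : s = 0 := Subsingleton.elim _ _
    subst this
    simp [evc, ee]
  | succ n IH =>
    intro M hb
    obtain ⟨R, hR⟩ := isBounded_iff_forall_norm_le.1 hb
    have : TT [] (0, -R) (0, R) ∩ HPoly M = HPoly M := by
      apply Set.inter_eq_right.2
      intro x hx
      have h1 := (norm_le_pi_norm x 0).trans (hR x hx)
      rw [Real.norm_eq_abs, abs_le] at h1
      exact ⟨by simp [HPoly], by simpa [aff] using h1.1, by simpa [aff] using h1.2⟩
    have h := main_step IH M [] (0, -R) (0, R)
    rw [this] at h
    exact h hb

lemma ERep_union {n : ℕ} (Ls : List (List ((Fin n → ℝ) × ℝ)))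
    (hb : ∀ L ∈ Ls, Bornology.IsBounded (HPoly L)) (C : List ((Fin n → ℝ) × ℝ)) :
    ERep n (FT (HPoly C ∩ ⋃ L ∈ Ls, HPoly L)) := by
  have hbU : ∀ Ls : List (List ((Fin n → ℝ) × ℝ)), (∀ L ∈ Ls, Bornology.IsBounded (HPoly L)) →
      Bornology.IsBounded (⋃ L ∈ Ls, HPoly L) := by
    intro Ls h
    exact (Bornology.isBounded_biUnion (List.finite_toSet Ls)).2 h
  induction Ls generalizing C with
  | nil =>
    have : HPoly C ∩ ⋃ L ∈ ([] : List (List ((Fin n → ℝ) × ℝ))), HPoly L = HPoly [(0, -1)] := by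
      ext x; simp [HPoly]
    rw [this]
    apply ERep_HPoly
    have : HPoly [((0 : Fin n → ℝ), (-1 : ℝ))] = ∅ := by
      ext x; simp [HPoly]
    rw [this]; exact Bornology.isBounded_empty
  | cons A Ls ih =>
    have h1 := ERep_HPoly (C ++ A) ((hb A (by simp)).subset (fun x hx =>
      ((mem_HPoly_append _ _ _).1 hx).2))
    have h2 := ih (fun L hL => hb L (by simp [hL])) C
    have h3 := ih (fun L hL => hb L (by simp [hL])) (C ++ A)
    refine ((h1.add h2).sub h3).congr fun s => ?_
    rw [FT_split _ (HPoly A) (⋃ L ∈ Ls, HPoly L) ((hbU _ hb).subset Set.inter_subset_right)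
      (isClosed_HPoly A).measurableSet (by
        intro x hx; simpa using hx.2) s]
    have e1 : (HPoly C ∩ ⋃ L ∈ A :: Ls, HPoly L) ∩ HPoly A = HPoly (C ++ A) := by
      ext x
      simp only [Set.mem_inter_iff, mem_HPoly_append, List.mem_cons, Set.iUnion_iUnion_eq_or_left,
        Set.mem_union]
      tauto
    have e2 : (HPoly C ∩ ⋃ L ∈ A :: Ls, HPoly L) ∩ ⋃ L ∈ Ls, HPoly L =
        HPoly C ∩ ⋃ L ∈ Ls, HPoly L := by
      ext x
      simp only [Set.mem_inter_iff, List.mem_cons, Set.iUnion_iUnion_eq_or_left,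
        Set.mem_union]
      tauto
    have e3 : HPoly C ∩ (⋃ L ∈ Ls, HPoly L) ∩ HPoly A =
        HPoly (C ++ A) ∩ ⋃ L ∈ Ls, HPoly L := by
      ext x
      simp only [Set.mem_inter_iff, mem_HPoly_append]
      tauto
    rw [e1, e2, e3]

lemma ERep_genPolytope {n : ℕ} (P : Set (EuclideanSpace ℝ (Fin n))) (hP : IsGenPolytope P) :
    ERep n (fun s : Fin n → ℝ => fourierTransformSet P (WithLp.toLp 2 s)) ∧
    Continuous (fun s : Fin n → ℝ => fourierTransformSet P (WithLp.toLp 2 s)) := by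
  obtain ⟨m, Q, hQ, rfl⟩ := hP
  choose V hV using hQ
  choose L hL using fun i => weyl_hull (V i)
  have hset : (⋃ i, Q i) = WithLp.ofLp ⁻¹' (⋃ M ∈ List.ofFn L, HPoly M) := by
    ext x
    simp only [Set.mem_iUnion, Set.mem_preimage, List.mem_ofFn, exists_prop]
    constructor
    · rintro ⟨i, hi⟩
      rw [(hV i).1, hL] at hi
      exact ⟨L i, ⟨i, rfl⟩, hi⟩
    · rintro ⟨_, ⟨i, rfl⟩, hi⟩
      exact ⟨i, by rw [(hV i).1, hL]; exact hi⟩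
  have hbd : ∀ M ∈ List.ofFn L, Bornology.IsBounded (HPoly M) := by
    intro M hM
    rw [List.mem_ofFn] at hM
    obtain ⟨i, rfl⟩ := hM
    have hc : IsCompact (convexHull ℝ (V i : Set (EuclideanSpace ℝ (Fin n)))) :=
      Set.Finite.isCompact_convexHull ℝ (V i).finite_toSet
    have : HPoly (L i) = WithLp.ofLp '' (convexHull ℝ (V i : Set (EuclideanSpace ℝ (Fin n)))) := by
      ext x
      constructor
      · intro hx
        exact ⟨WithLp.toLp 2 x, (hL i _).2 hx, rfl⟩
      · rintro ⟨y, hy, rfl⟩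
        exact (hL i _).1 hy
    rw [this]
    exact (hc.image (PiLp.continuous_ofLp 2 _)).isBounded
  have hFT : ∀ s : Fin n → ℝ, fourierTransformSet (⋃ i, Q i) (WithLp.toLp 2 s) =
      FT (HPoly [] ∩ ⋃ M ∈ List.ofFn L, HPoly M) s := by
    intro s
    have : HPoly [] ∩ (⋃ M ∈ List.ofFn L, HPoly M) = ⋃ M ∈ List.ofFn L, HPoly M := by
      ext x; simp [HPoly]
    rw [this, hset, fourierTransformSet, FT,
      ← (PiLp.volume_preserving_ofLp (Fin n)).setIntegral_preimage_emb
        (MeasurableEquiv.toLp 2 (Fin n → ℝ)).symm.measurableEmbedding]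
    congr 1
    ext x
    simp [ee, PiLp.inner_apply, dotProduct, mul_comm]
  refine ⟨(ERep_union _ hbd []).congr hFT, ?_⟩
  have hbU : Bornology.IsBounded (⋃ M ∈ List.ofFn L, HPoly M) :=
    (Bornology.isBounded_biUnion (List.finite_toSet (List.ofFn L))).2 hbd
  have hb2 := hbU.subset (Set.inter_subset_right (s := HPoly []))
  simp_rw [hFT]
  unfold FT
  generalize HPoly [] ∩ (⋃ M ∈ List.ofFn L, HPoly M) = T at hb2
  refine continuous_of_dominated (bound := fun _ => 1) ?_ ?_ ?_ ?_
  · intro s; exact (continuous_ee s).aestronglyMeasurable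
  · intro s
    refine Filter.Eventually.of_forall fun x => ?_
    rw [ee, Complex.norm_exp]
    simp
  · have := (integrableOn_ee T hb2 0).norm
    refine Integrable.congr this (Filter.Eventually.of_forall fun x => ?_)
    simp [ee]
  · refine Filter.Eventually.of_forall fun x => ?_
    unfold ee dotProduct
    fun_prop

end

lemma mv_zero_of_open {n : ℕ} {R : Type*} [CommRing R] [IsDomain R] (φ : ℝ → R)
    (hφ : Function.Injective φ) (p : MvPolynomial (Fin n) R) (U : Set (Fin n → ℝ))
    (hU : IsOpen U) (hne : U.Nonempty)
    (h : ∀ t ∈ U, MvPolynomial.eval (fun i => φ (t i)) p = 0) : p = 0 := by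
  obtain ⟨x, hx⟩ := hne
  obtain ⟨ε, hε, hb⟩ := Metric.isOpen_iff.1 hU x hx
  refine MvPolynomial.funext_set (fun i => φ '' Metric.ball (x i) ε) ?_ ?_
  · intro i
    exact (infinite_of_mem_nhds (x i) (Metric.ball_mem_nhds _ hε)).image hφ.injOn
  · intro y hy
    choose z hz hzy using fun i => hy i (Set.mem_univ i)
    have : y = fun i => φ (z i) := funext fun i => (hzy i).symm
    rw [this, map_zero]
    refine h z (hb ?_)
    rw [Metric.mem_ball, dist_pi_lt_iff hε]
    exact fun i => hz i

lemma evc_smul {n d : ℕ} (p : MvPolynomial (Fin n) ℂ) (hp : p.IsHomogeneous d) (c : ℝ)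
    (s : Fin n → ℝ) : evc p (fun i => c * s i) = (c : ℂ) ^ d * evc p s := by
  simp only [evc, MvPolynomial.eval_eq, Finset.mul_sum]
  refine Finset.sum_congr rfl fun e he => ?_
  have hd : ∑ i, e i = d := by
    have := hp (MvPolynomial.mem_support_iff.1 he)
    rw [← this, Finsupp.weight_apply, Finsupp.sum_fintype _ _ (by simp)]
    simp
  have : ∏ i ∈ e.support, (((c * s i : ℝ) : ℂ)) ^ e i =
      (c:ℂ) ^ d * ∏ i ∈ e.support, ((s i : ℂ)) ^ e i := by
    simp only [Complex.ofReal_mul, mul_pow, Finset.prod_mul_distrib]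
    congr 1
    rw [Finset.prod_pow_eq_pow_sum, ← hd]
    congr 1
    exact Finset.sum_subset (Finset.subset_univ _) (by simp)
  rw [this]; ring

noncomputable def lineP {m : ℕ} (t u : Fin m → ℝ) :
    MvPolynomial (Fin m) ℝ →ₐ[ℝ] Polynomial ℂ :=
  MvPolynomial.aeval (fun i => Polynomial.C (t i : ℂ) + Polynomial.C (u i : ℂ) * Polynomial.X)

lemma eval_lineP {m : ℕ} (t u : Fin m → ℝ) (P : MvPolynomial (Fin m) ℝ) (τ : ℝ) :
    (lineP t u P).eval (τ : ℂ) = ((MvPolynomial.eval (fun i => t i + τ * u i) P : ℝ) : ℂ) := by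
  induction P using MvPolynomial.induction_on with
  | C a =>
    simp only [lineP, MvPolynomial.algHom_C, MvPolynomial.eval_C]
    rw [IsScalarTower.algebraMap_apply ℝ ℂ (Polynomial ℂ)]
    simp
  | add p q hp hq => simp [hp, hq]
  | mul_X p i hp =>
    rw [map_mul, Polynomial.eval_mul, hp]
    (simp only [lineP, MvPolynomial.aeval_X, Polynomial.eval_add, Polynomial.eval_mul, Polynomial.eval_C, Polynomial.eval_X, map_mul, MvPolynomial.eval_X]; push_cast; ring)

lemma eval_aevalP {n : ℕ} (q : MvPolynomial (Fin n) ℂ) (f : Fin n → Polynomial ℂ) (z : ℂ) :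
    (MvPolynomial.aeval f q).eval z = MvPolynomial.eval (fun j => (f j).eval z) q := by
  induction q using MvPolynomial.induction_on with
  | C a => simp
  | add p q hp hq => simp [hp, hq]
  | mul_X p i hp => rw [map_mul, Polynomial.eval_mul, hp]; simp

lemma coeff_vanish {m d : ℕ} (V : Finset (Fin (m+1) → ℝ))
    (q : (Fin (m+1) → ℝ) → MvPolynomial (Fin (m+1)) ℂ) (hq : ∀ w, (q w).IsHomogeneous d)
    (N : Fin (m+1) → MvPolynomial (Fin m) ℝ) (H : MvPolynomial (Fin m) ℝ)
    (σ : (Fin m → ℝ) → Fin (m+1) → ℝ) (O : Set (Fin m → ℝ)) (hO : IsOpen O)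
    (hH : ∀ t ∈ O, MvPolynomial.eval t H ≠ 0)
    (hσ : ∀ t ∈ O, ∀ j, MvPolynomial.eval t (N j) = MvPolynomial.eval t H * σ t j)
    (hhyp : ∀ (a : Fin (m+1) → ℝ) (c : ℝ), a ≠ 0 → ¬ ∀ t ∈ O, a ⬝ᵥ σ t = c)
    (hsum : ∀ t ∈ O, ∑ w ∈ V, evc (q w) (σ t) * ee (σ t) w = 0) :
    ∀ w ∈ V, ∀ t ∈ O, evc (q w) (σ t) = 0 := by
  classical
  intro w₀ hw₀ t1 ht1
  obtain ⟨ε, hε, hball⟩ := Metric.isOpen_iff.1 hO t1 ht1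
  -- a polynomial detecting non-constancy
  let c : (Fin (m+1) → ℝ) → ℝ := fun a => a ⬝ᵥ σ t1
  let R : (Fin (m+1) → ℝ) → MvPolynomial (Fin m) ℝ := fun a =>
    ∑ j, MvPolynomial.C (a j) * N j - MvPolynomial.C (c a) * H
  have hReval : ∀ a, ∀ t ∈ O, MvPolynomial.eval t (R a) =
      MvPolynomial.eval t H * (a ⬝ᵥ σ t - c a) := by
    intro a t ht
    simp only [R, map_sub, map_sum, map_mul, MvPolynomial.eval_C, hσ t ht, dotProduct]
    rw [mul_sub, Finset.mul_sum]
    congr 1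
    · exact Finset.sum_congr rfl fun j _ => by ring
    · ring
  have hR0 : ∀ a, a ≠ 0 → R a ≠ 0 := by
    intro a ha h0
    refine hhyp a (c a) ha fun t ht => ?_
    have := hReval a t ht
    rw [h0, map_zero] at this
    rcases mul_eq_zero.1 this.symm with h | h
    · exact absurd h (hH t ht)
    · linarith
  let PP := ∏ ab ∈ V.offDiag, R (ab.1 - ab.2)
  have hPP : PP ≠ 0 := by
    refine Finset.prod_ne_zero_iff.2 fun ab hab => hR0 _ ?_
    exact sub_ne_zero.2 (Finset.mem_offDiag.1 hab).2.2
  obtain ⟨t2, ht2, hPP2⟩ : ∃ t2 ∈ Metric.ball t1 ε, MvPolynomial.eval t2 PP ≠ 0 := by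
    by_contra! hcon
    exact hPP (mv_zero_of_open id Function.injective_id PP _ Metric.isOpen_ball
      ⟨t1, Metric.mem_ball_self hε⟩ hcon)
  let u : Fin m → ℝ := t2 - t1
  let γ : ℝ → Fin m → ℝ := fun τ i => t1 i + τ * u i
  have hγc : Continuous γ := by unfold γ; fun_prop
  have hγ0 : γ 0 = t1 := by ext i; simp [γ]
  have hγ1 : γ 1 = t2 := by ext i; simp [γ, u]
  let U : Set ℝ := γ ⁻¹' O
  have hU : IsOpen U := hO.preimage hγc
  have h0U : (0:ℝ) ∈ U := by simpa [U, hγ0] using ht1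
  have h1U : (1:ℝ) ∈ U := by simpa [U, hγ1] using hball ht2
  have hev : ∀ (P : MvPolynomial (Fin m) ℝ) (τ : ℝ), (lineP t1 u P).eval (τ : ℂ) = ((MvPolynomial.eval (γ τ) P : ℝ) : ℂ) :=
    fun P τ => eval_lineP t1 u P τ
  let h := lineP t1 u H
  let g : (Fin (m+1) → ℝ) → Polynomial ℂ := fun w => ∑ j, Polynomial.C (w j : ℂ) * lineP t1 u (N j)
  let r : (Fin (m+1) → ℝ) → Polynomial ℂ := fun w =>
    MvPolynomial.aeval (fun j => lineP t1 u (N j)) (q w)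
  have hh : ∀ τ ∈ U, h.eval (τ : ℂ) ≠ 0 := by
    intro τ hτ
    rw [hev]
    exact_mod_cast hH _ hτ
  have hgev : ∀ w, ∀ τ ∈ U, (g w).eval (τ : ℂ) = h.eval (τ:ℂ) * ((σ (γ τ) ⬝ᵥ w : ℝ) : ℂ) := by
    intro w τ hτ
    simp only [g, h, Polynomial.eval_finsetSum, Polynomial.eval_mul, Polynomial.eval_C, hev,
      hσ _ hτ, dotProduct]
    push_cast
    rw [Finset.mul_sum]
    exact Finset.sum_congr rfl fun j _ => by ring
  have hrev : ∀ w, ∀ τ ∈ U, (r w).eval (τ : ℂ) = (h.eval (τ:ℂ)) ^ d * evc (q w) (σ (γ τ)) := by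
    intro w τ hτ
    simp only [r, h]
    rw [eval_aevalP]
    simp only [hev, hσ _ hτ]
    exact evc_smul (q w) (hq w) _ _
  have key := exp_indep V h g U hU ⟨0, h0U⟩ hh ?_ r ?_
  · have := hrev w₀ 0 h0U
    rw [key w₀ hw₀, Polynomial.eval_zero, hγ0] at this
    rcases mul_eq_zero.1 this.symm with h' | h'
    · exact absurd h' (pow_ne_zero _ (hh 0 h0U))
    · exact h'
  · rintro a ha b hb hab ⟨κ, hκ⟩
    have e : ∀ τ ∈ U, (((a - b) ⬝ᵥ σ (γ τ) : ℝ) : ℂ) = κ := by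
      intro τ hτ
      have := congrArg (Polynomial.eval (τ:ℂ)) hκ
      rw [Polynomial.eval_sub, Polynomial.eval_mul, Polynomial.eval_C, hgev a τ hτ,
        hgev b τ hτ] at this
      apply mul_left_cancel₀ (hh τ hτ)
      rw [sub_dotProduct, dotProduct_comm a, dotProduct_comm b]
      push_cast
      linear_combination this
    have e0 := e 0 h0U
    have e1 := e 1 h1U
    rw [← e0, hγ0, hγ1] at e1
    have e2 : (a - b) ⬝ᵥ σ t2 = (a - b) ⬝ᵥ σ t1 := by exact_mod_cast e1
    apply hPP2
    simp only [PP, map_prod]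
    refine Finset.prod_eq_zero (Finset.mem_offDiag.2 ⟨ha, hb, hab⟩ : (a, b) ∈ V.offDiag) ?_
    rw [hReval _ _ (hball ht2), e2]
    simp [c]
  · intro τ hτ
    have := hsum _ hτ
    have e := congrArg (fun z => (h.eval (τ:ℂ)) ^ d * z) this
    simp only [mul_zero, Finset.mul_sum] at e
    rw [← e]
    refine Finset.sum_congr rfl fun w _ => ?_
    rw [hrev w τ hτ, hgev w τ hτ, mul_div_cancel_left₀ _ (hh τ hτ), ee]
    ring

lemma hom_vanish {m d : ℕ} (q : MvPolynomial (Fin (m+1)) ℂ) (hq : q.IsHomogeneous d)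
    (σ : (Fin m → ℝ) → Fin (m+1) → ℝ) (O : Set (Fin m → ℝ)) (h0 : ∀ t ∈ O, σ t 0 ≠ 0)
    (hinner : (interior ((fun t' : Fin m → ℝ => fun i : Fin m => σ t' i.succ / σ t' 0) '' O)).Nonempty)
    (hz : ∀ t ∈ O, evc q (σ t) = 0) : q = 0 := by
  obtain ⟨y, hy⟩ := hinner
  set W := interior ((fun t' : Fin m → ℝ => fun i : Fin m => σ t' i.succ / σ t' 0) '' O) with hW
  let f : (Fin (m+1) → ℝ) → Fin m → ℝ := fun s i => s i.succ / s 0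
  let Ω : Set (Fin (m+1) → ℝ) := {s | 0 < s 0} ∩ f ⁻¹' W
  have hΩ : IsOpen Ω := by
    refine ContinuousOn.isOpen_inter_preimage ?_ (isOpen_lt continuous_const (by fun_prop))
      isOpen_interior
    refine continuousOn_pi.2 fun i => ContinuousOn.div (by fun_prop) (by fun_prop) ?_
    intro s hs
    exact ne_of_gt hs
  refine mv_zero_of_open _ Complex.ofReal_injective q Ω hΩ ⟨Fin.cons 1 y, ?_, ?_⟩ ?_
  · simp
  · simpa [f] using hy
  · rintro s ⟨hs0, hsW⟩
    obtain ⟨t, ht, hts⟩ := interior_subset hsW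
    have hs0' : s 0 ≠ 0 := ne_of_gt hs0
    have e : s = fun i => (s 0 / σ t 0) * σ t i := by
      ext i
      refine Fin.cases ?_ (fun i => ?_) i
      · field_simp [h0 t ht]
      · have := congrFun hts i
        simp only [f] at this
        have h1 := h0 t ht
        field_simp at this ⊢
        linarith
    have := evc_smul q hq (s 0 / σ t 0) (σ t)
    rw [← e, hz t ht, mul_zero] at this
    exact this

/-- **Statement 0** (with `n = m + 1 ≥ 2`). If two generalized polytopes have equal Fourier
transforms on `σ(O)` for a rationally parameterisable hypersurface `σ` and an open nonempty
`O ⊆ D ∖ σ₁⁻¹(0)` satisfying the hyperplane condition and the inner point condition,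
then the polytopes coincide. -/
theorem fourier_eq_on_rp_hypersurface_extends_globally
    (m : ℕ) (hm : 1 ≤ m)
    (P₁ P₂ : Set (EuclideanSpace ℝ (Fin (m + 1))))
    (hP₁ : IsGenPolytope P₁) (hP₂ : IsGenPolytope P₂)
    (D : Set (Fin m → ℝ))
    (σ : (Fin m → ℝ) → EuclideanSpace ℝ (Fin (m + 1)))
    -- each component of σ is a rational function whose denominator does not vanish on D
    (hrat : ∀ j : Fin (m + 1), ∃ A B : MvPolynomial (Fin m) ℝ,
      ∀ t ∈ D, MvPolynomial.eval t B ≠ 0 ∧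
        σ t j = MvPolynomial.eval t A / MvPolynomial.eval t B)
    (O : Set (Fin m → ℝ)) (hOopen : IsOpen O) (hOne : O.Nonempty)
    -- O ⊆ D ∖ σ₁⁻¹(0)
    (hOD : ∀ t ∈ O, t ∈ D ∧ σ t 0 ≠ 0)
    -- hyperplane condition: σ(O) is not contained in an affine hyperplane
    (hhyp : ¬ ∃ (a : EuclideanSpace ℝ (Fin (m + 1))) (c : ℝ), a ≠ 0 ∧
      ∀ t ∈ O, ⟪a, σ t⟫ = c)
    -- inner point condition: some σ̂(t) is an interior point of σ̂(O)
    (hinner : ∃ t ∈ O, (fun i : Fin m => σ t i.succ / σ t 0) ∈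
      interior ((fun t' : Fin m → ℝ => fun i : Fin m => σ t' i.succ / σ t' 0) '' O))
    (heq : ∀ t ∈ O, fourierTransformSet P₁ (σ t) = fourierTransformSet P₂ (σ t)) :
    ∀ s : EuclideanSpace ℝ (Fin (m + 1)),
      fourierTransformSet P₁ s = fourierTransformSet P₂ s := by
  classical
  obtain ⟨hR₁, hC₁⟩ := ERep_genPolytope P₁ hP₁
  obtain ⟨hR₂, hC₂⟩ := ERep_genPolytope P₂ hP₂
  obtain ⟨d, Q, hQ, hQh, ι, _, p, v, hp, hsum⟩ := hR₁.sub hR₂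
  let V : Finset (Fin (m+1) → ℝ) := Finset.univ.image v
  let q : (Fin (m+1) → ℝ) → MvPolynomial (Fin (m+1)) ℂ := fun w =>
    ∑ i with v i = w, p i
  have hq : ∀ w, (q w).IsHomogeneous d := fun w =>
    MvPolynomial.IsHomogeneous.sum _ _ _ fun i _ => hp i
  have hpool : ∀ s, ∑ i, evc (p i) s * ee s (v i) = ∑ w ∈ V, evc (q w) s * ee s w := by
    intro s
    rw [← Finset.sum_fiberwise_of_maps_to (t := V) (g := v)
      (fun i _ => Finset.mem_image_of_mem _ (Finset.mem_univ i))]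
    refine Finset.sum_congr rfl fun w _ => ?_
    simp only [q, evc, map_sum, Finset.sum_mul]
    refine Finset.sum_congr rfl fun i hi => ?_
    rw [(Finset.mem_filter.1 hi).2]
  choose A B hAB using hrat
  let H : MvPolynomial (Fin m) ℝ := ∏ j, B j
  let N : Fin (m+1) → MvPolynomial (Fin m) ℝ := fun j => A j * ∏ k ∈ Finset.univ.erase j, B k
  have hH : ∀ t ∈ O, MvPolynomial.eval t H ≠ 0 := by
    intro t ht
    simp only [H, map_prod]
    exact Finset.prod_ne_zero_iff.2 fun j _ => (hAB j t (hOD t ht).1).1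
  have hN : ∀ t ∈ O, ∀ j, MvPolynomial.eval t (N j) =
      MvPolynomial.eval t H * (σ t).ofLp j := by
    intro t ht j
    obtain ⟨h1, h2⟩ := hAB j t (hOD t ht).1
    have : H = B j * ∏ k ∈ Finset.univ.erase j, B k :=
      (Finset.mul_prod_erase _ _ (Finset.mem_univ j)).symm
    rw [h2, this]
    simp only [N, map_mul]
    field_simp
  have hvan := coeff_vanish V q hq N H (fun t => (σ t).ofLp) O hOopen hH hN (by
      intro a c ha hcon
      refine hhyp ⟨WithLp.toLp 2 a, c, ?_, fun t ht => ?_⟩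
      · intro h; apply ha
        simpa using congrArg WithLp.ofLp h
      · rw [← hcon t ht]
        simp [PiLp.inner_apply, dotProduct, mul_comm]) (by
      intro t ht
      rw [← hpool, ← hsum]
      simp only [WithLp.toLp_ofLp, heq t ht, sub_self, mul_zero])
  have hq0 : ∀ w ∈ V, q w = 0 := by
    intro w hw
    refine hom_vanish (q w) (hq w) (fun t => (σ t).ofLp) O (fun t ht => (hOD t ht).2) ?_ (hvan w hw)
    obtain ⟨t, _, h⟩ := hinner
    exact ⟨_, h⟩
  have hzero : ∀ s, evc Q s * (fourierTransformSet P₁ (WithLp.toLp 2 s) -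
      fourierTransformSet P₂ (WithLp.toLp 2 s)) = 0 := by
    intro s
    rw [hsum, hpool]
    exact Finset.sum_eq_zero fun w hw => by rw [hq0 w hw]; simp [evc]
  intro s
  by_contra hne
  apply hQ
  refine mv_zero_of_open _ Complex.ofReal_injective Q
    ((fun s : Fin (m+1) → ℝ => fourierTransformSet P₁ (WithLp.toLp 2 s) -
      fourierTransformSet P₂ (WithLp.toLp 2 s)) ⁻¹' {0}ᶜ)
    (isOpen_compl_singleton.preimage (hC₁.sub hC₂)) ⟨s.ofLp, ?_⟩ ?_
  · simpa [sub_eq_zero] using hne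
  · intro t ht
    exact (mul_eq_zero.1 (hzero t)).resolve_right ht
end

section
/- Let m ≥ 1 and for each k ∈ {1,…,m} let p_k and r_k be rational functions in one variable with complex coefficients (elements of ℂ(x)), such that for all k ≠ k' the difference r_k − r_{k'} is not a constant rational function. Let I be a nonempty open interval in ℝ on which all the p_k and r_k are defined (no denominator vanishes on I). If ∑_{k=1}^m p_k(x) · exp(r_k(x)) = 0 for every x ∈ I, then p_k is the zero rational function for every k ∈ {1,…,m}. -/
open Polynomial in
lemma aux_deriv (t A : ℂ[X]) (ht : derivative t = 1) (a : ℕ) :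
    t * derivative (t ^ a * A) = t ^ a * (C (a : ℂ) * A + t * derivative A) := by
  rw [derivative_mul, derivative_pow, ht]
  cases a with
  | zero => simp
  | succ n =>
    simp only [Nat.add_sub_cancel]
    ring

open Polynomial in
lemma aux_coprime (A B U V : ℂ[X]) (hA : A ≠ 0) (hB : B ≠ 0) (hV : V ≠ 0) (hc : IsCoprime U V)
    (h : (A * derivative B - derivative A * B) * V ^ 2
      + A * B * (derivative U * V - U * derivative V) = 0) :
    ∃ c : ℂ, U = C c * V := by
  have hroot : ∀ z, V.eval z ≠ 0 := by
    intro z hz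
    obtain ⟨A1, hA1, hA2⟩ := exists_eq_pow_rootMultiplicity_mul_and_not_dvd A hA z
    obtain ⟨B1, hB1, hB2⟩ := exists_eq_pow_rootMultiplicity_mul_and_not_dvd B hB z
    obtain ⟨V1, hV1, hV2⟩ := exists_eq_pow_rootMultiplicity_mul_and_not_dvd V hV z
    have hn : 0 < rootMultiplicity z V := (rootMultiplicity_pos hV).2 hz
    generalize rootMultiplicity z A = a at *
    generalize rootMultiplicity z B = b at *
    generalize rootMultiplicity z V = n at *
    rw [dvd_iff_isRoot, IsRoot.def] at hA2 hB2 hV2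
    have hU : U.eval z ≠ 0 := by
      intro hU
      obtain ⟨u, v, huv⟩ := hc
      have := congrArg (eval z) huv
      simp [hU, hz] at this
    have ht : derivative (X - C z) = 1 := by simp
    have ht0 : (X - C z) ≠ 0 := X_sub_C_ne_zero z
    have ez : eval z (X - C z) = 0 := by simp
    generalize X - C z = t at *
    have dA := aux_deriv t A1 ht a
    have dB := aux_deriv t B1 ht b
    have dV := aux_deriv t V1 ht n
    rw [← hA1] at dA
    rw [← hB1] at dB
    rw [← hV1] at dV
    have key : t ^ (a + b + n) * ((A1 * (C (b : ℂ) * B1 + t * derivative B1)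
        - (C (a : ℂ) * A1 + t * derivative A1) * B1) * t ^ n * V1 ^ 2
        + A1 * B1 * (t * derivative U * V1 - U * (C (n : ℂ) * V1 + t * derivative V1))) = 0 := by
      have h' : (A * (t * derivative B) - (t * derivative A) * B) * V ^ 2
        + A * B * (t * derivative U * V - U * (t * derivative V)) = 0 := by
        linear_combination t * h
      rw [dA, dB, dV, hA1, hB1, hV1] at h'
      rw [← h']
      ring
    have key2 := (mul_eq_zero.1 key).resolve_left (pow_ne_zero _ ht0)
    have := congrArg (eval z) key2
    simp [ez, hn.ne', hA2, hB2, hV2, hU] at this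
  have hdeg : V.degree = 0 := by
    by_contra hd
    obtain ⟨z, hz⟩ := Complex.exists_root (f := V)
      (lt_of_le_of_ne (zero_le_degree_iff.2 hV) (Ne.symm hd))
    exact hroot z hz
  obtain ⟨v, rfl⟩ : ∃ v, V = C v := ⟨_, eq_C_of_degree_eq_zero hdeg⟩
  have hv : v ≠ 0 := by rintro rfl; simp at hV
  have h2 : A * B * derivative U = C v * (derivative A * B - A * derivative B) := by
    have : C v * (A * B * derivative U - C v * (derivative A * B - A * derivative B)) = 0 := by
      rw [← h]; simp; ring
    exact sub_eq_zero.1 ((mul_eq_zero.1 this).resolve_left hV)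
  have hU' : derivative U = 0 := by
    by_contra hU'
    have hAB : A * B ≠ 0 := mul_ne_zero hA hB
    have h3 : (A * B).degree ≤ (A * B * derivative U).degree := degree_le_mul_left _ hU'
    have h4 : (C v * (derivative A * B - A * derivative B)).degree < (A * B).degree := by
      rw [degree_C_mul hv]
      refine lt_of_le_of_lt (degree_sub_le _ _) (max_lt ?_ ?_)
      · rw [degree_mul, degree_mul, add_comm, add_comm A.degree]
        exact WithBot.add_lt_add_left (by simpa using hB) (degree_derivative_lt hA)
      · rw [degree_mul, degree_mul]
        exact WithBot.add_lt_add_left (by simpa using hA) (degree_derivative_lt hB)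
    rw [h2] at h3
    exact absurd h4 (not_lt.2 h3)
  have := natDegree_eq_zero_of_derivative_eq_zero hU'
  obtain ⟨u, rfl⟩ := natDegree_eq_zero.1 this
  exact ⟨u / v, by rw [← C_mul, div_mul_cancel₀ _ hv]⟩

open Polynomial in
lemma aux_alg (A B U V : ℂ[X]) (hA : A ≠ 0) (hB : B ≠ 0) (hV : V ≠ 0)
    (h : (A * derivative B - derivative A * B) * V ^ 2
      + A * B * (derivative U * V - U * derivative V) = 0) :
    ∃ c : ℂ, U = C c * V := by
  obtain ⟨U0, hU0⟩ := EuclideanDomain.gcd_dvd_left U V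
  obtain ⟨V0, hV0⟩ := EuclideanDomain.gcd_dvd_right U V
  have hg : EuclideanDomain.gcd U V ≠ 0 := fun h => hV (EuclideanDomain.gcd_eq_zero_iff.1 h).2
  have hbez := EuclideanDomain.gcd_eq_gcd_ab U V
  generalize EuclideanDomain.gcdA U V = α at *
  generalize EuclideanDomain.gcdB U V = β at *
  generalize EuclideanDomain.gcd U V = g at *
  subst hU0 hV0
  have hc : IsCoprime U0 V0 := by
    refine ⟨α, β, mul_left_cancel₀ hg ?_⟩
    linear_combination -hbez
  obtain ⟨c, hc⟩ := aux_coprime A B U0 V0 hA hB (right_ne_zero_of_mul hV) hc (by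
    have : g ^ 2 * ((A * derivative B - derivative A * B) * V0 ^ 2
      + A * B * (derivative U0 * V0 - U0 * derivative V0)) = 0 := by
      rw [← h]; simp only [derivative_mul]; ring
    exact (mul_eq_zero.1 this).resolve_left (pow_ne_zero _ hg))
  exact ⟨c, by rw [hc]; ring⟩

open Polynomial in
lemma aux_zero (P : ℂ[X]) (a b : ℝ) (hab : a < b)
    (h : ∀ x ∈ Set.Ioo a b, P.eval (x : ℂ) = 0) : P = 0 := by
  refine eq_zero_of_infinite_isRoot P ?_
  refine Set.Infinite.mono (s := (fun x : ℝ => (x : ℂ)) '' Set.Ioo a b) ?_ ?_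
  · rintro _ ⟨x, hx, rfl⟩
    exact h x hx
  · exact (Set.Ioo_infinite hab).image Complex.ofReal_injective.injOn

open Polynomial in
lemma aux_main {ι : Type*} [DecidableEq ι] (U : ι → ℂ[X]) (V : ℂ[X]) (a b : ℝ) (hab : a < b)
    (hV : ∀ x ∈ Set.Ioo a b, V.eval (x : ℂ) ≠ 0)
    (hU : ∀ i j, i ≠ j → ∀ c : ℂ, U i - U j ≠ C c * V) (S : Finset ι) :
    ∀ P : ι → ℂ[X], (∀ x ∈ Set.Ioo a b, ∑ k ∈ S, (P k).eval (x : ℂ) *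
      Complex.exp ((U k).eval (x : ℂ) / V.eval (x : ℂ)) = 0) → ∀ k ∈ S, P k = 0 := by
  have hV0 : V ≠ 0 := by
    rintro rfl
    obtain ⟨x, hx⟩ := exists_between hab
    exact hV x hx (by simp)
  induction S using Finset.induction_on with
  | empty => simp
  | insert j S hj ih =>
    intro P hP
    by_cases hPj : P j = 0
    · intro k hk
      rcases Finset.mem_insert.1 hk with rfl | hk
      · exact hPj
      · refine ih P (fun x hx => ?_) k hk
        have := hP x hx
        rwa [Finset.sum_insert hj, hPj, eval_zero, zero_mul, zero_add] at this
    exfalso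
    let D : ι → ℂ[X] := fun k => derivative (U k) * V - U k * derivative V
    let G : ι → ℂ[X] := fun k => derivative (P k) * V ^ 2 + P k * D k
    have hder : ∀ x ∈ Set.Ioo a b, ∑ k ∈ insert j S, (G k).eval (x : ℂ) *
        Complex.exp ((U k).eval (x : ℂ) / V.eval (x : ℂ)) = 0 := by
      intro x hx
      have h1 : HasDerivAt (fun z : ℂ => ∑ k ∈ insert j S, (P k).eval z *
          Complex.exp ((U k).eval z / V.eval z)) (∑ k ∈ insert j S,
          ((derivative (P k)).eval (x : ℂ) * Complex.exp ((U k).eval (x : ℂ) / V.eval (x : ℂ)) +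
          (P k).eval (x : ℂ) * (Complex.exp ((U k).eval (x : ℂ) / V.eval (x : ℂ)) *
          (((derivative (U k)).eval (x : ℂ) * V.eval (x : ℂ)
            - (U k).eval (x : ℂ) * (derivative V).eval (x : ℂ)) / V.eval (x : ℂ) ^ 2)))) (x : ℂ) := by
        refine HasDerivAt.fun_sum fun k _ => ?_
        exact ((P k).hasDerivAt _).mul
          ((((U k).hasDerivAt _).div (V.hasDerivAt _) (hV x hx)).cexp)
      have h2 := h1.comp_ofReal
      have h3 : HasDerivAt (fun y : ℝ => ∑ k ∈ insert j S, (P k).eval (y : ℂ) *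
          Complex.exp ((U k).eval (y : ℂ) / V.eval (y : ℂ))) 0 x := by
        refine (hasDerivAt_const x (0 : ℂ)).congr_of_eventuallyEq ?_
        filter_upwards [isOpen_Ioo.mem_nhds hx] with y hy using hP y hy
      have h4 := h2.unique h3
      have h5 := congrArg (fun w => V.eval (x : ℂ) ^ 2 * w) h4
      simp only [mul_zero, Finset.mul_sum] at h5
      rw [← h5]
      refine Finset.sum_congr rfl fun k _ => ?_
      have := hV x hx
      simp only [G, D, eval_add, eval_sub, eval_mul, eval_pow]
      field_simp
    have hQ := ih (fun k => P j * G k - G j * P k) (fun x hx => by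
      have e1 := hP x hx
      have e2 := hder x hx
      have : ∑ k ∈ insert j S, (P j * G k - G j * P k).eval (x : ℂ) *
        Complex.exp ((U k).eval (x : ℂ) / V.eval (x : ℂ)) = 0 := by
        calc _ = (P j).eval (x : ℂ) * ∑ k ∈ insert j S, (G k).eval (x : ℂ) *
                Complex.exp ((U k).eval (x : ℂ) / V.eval (x : ℂ))
              - (G j).eval (x : ℂ) * ∑ k ∈ insert j S, (P k).eval (x : ℂ) *
                Complex.exp ((U k).eval (x : ℂ) / V.eval (x : ℂ)) := by
              rw [Finset.mul_sum, Finset.mul_sum, ← Finset.sum_sub_distrib]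
              refine Finset.sum_congr rfl fun k _ => ?_
              simp only [eval_sub, eval_mul]
              ring
          _ = 0 := by rw [e1, e2]; simp
      rw [Finset.sum_insert hj] at this
      rw [show P j * G j - G j * P j = 0 by ring, eval_zero, zero_mul, zero_add] at this
      exact this)
    have hPk : ∀ k ∈ S, P k = 0 := by
      intro k hk
      by_contra hne
      have hkj : k ≠ j := by rintro rfl; exact hj hk
      obtain ⟨c, hc⟩ := aux_alg (P j) (P k) (U k - U j) V hPj hne hV0 (by
        have := hQ k hk
        simp only [G, D] at this
        rw [← this, derivative_sub]
        ring)
      exact hU k j hkj c hc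
    refine hPj (aux_zero _ a b hab fun x hx => ?_)
    have := hP x hx
    rw [Finset.sum_insert hj, Finset.sum_eq_zero (fun k hk => by rw [hPk k hk]; simp), add_zero]
      at this
    exact (mul_eq_zero.1 this).resolve_right (Complex.exp_ne_zero _)

open Polynomial in
lemma aux_common {m : ℕ} (r : Fin m → RatFunc ℂ) (I : Set ℝ)
    (h : ∀ k, ∀ x ∈ I, (r k).denom.eval (x : ℂ) ≠ 0) :
    ∃ (U : Fin m → ℂ[X]) (V : ℂ[X]), V ≠ 0 ∧ (∀ x ∈ I, V.eval (x : ℂ) ≠ 0) ∧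
      (∀ k, r k = algebraMap ℂ[X] (RatFunc ℂ) (U k) / algebraMap ℂ[X] (RatFunc ℂ) V) ∧
      ∀ k, ∀ x ∈ I, RatFunc.eval (RingHom.id ℂ) (x : ℂ) (r k)
        = (U k).eval (x : ℂ) / V.eval (x : ℂ) := by
  have hVk : ∀ k, ∏ i, (r i).denom = (r k).denom * ∏ i ∈ Finset.univ.erase k, (r i).denom :=
    fun k => (Finset.mul_prod_erase _ _ (Finset.mem_univ k)).symm
  have hV0 : ∏ i, (r i).denom ≠ 0 := Finset.prod_ne_zero_iff.2 fun i _ => (r i).denom_ne_zero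
  have hVx : ∀ x ∈ I, (∏ i, (r i).denom).eval (x : ℂ) ≠ 0 := by
    intro x hx
    rw [eval_prod]
    exact Finset.prod_ne_zero_iff.2 fun i _ => h i x hx
  refine ⟨fun k => (r k).num * ∏ i ∈ Finset.univ.erase k, (r i).denom, ∏ i, (r i).denom,
    hV0, hVx, fun k => ?_, fun k x hx => ?_⟩
  · rw [hVk k] at hV0 ⊢
    rw [map_mul, map_mul, mul_div_mul_right, RatFunc.num_div_denom]
    exact RatFunc.algebraMap_ne_zero (right_ne_zero_of_mul hV0)
  · have := hVx x hx
    rw [hVk k, eval_mul] at this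
    rw [hVk k, eval_mul, eval_mul, mul_div_mul_right _ _ (right_ne_zero_of_mul this)]
    simp [RatFunc.eval, eval₂_id]


/-- If rational functions `p k, r k ∈ ℂ(x)` are such that `r k - r k'` is
never constant for `k ≠ k'`, all of them are defined on a nonempty open real interval `I`
(no denominator vanishes on `I`), and `∑ k, p k (x) · exp (r k (x)) = 0` on `I`, then all
`p k` are the zero rational function. -/
theorem independence_of_rational_exponentials
    (m : ℕ) (hm : 1 ≤ m) (p r : Fin m → RatFunc ℂ)
    -- r_k - r_{k'} is not a constant rational function for k ≠ k'
    (hnc : ∀ k k' : Fin m, k ≠ k' → ∀ c : ℂ, r k - r k' ≠ RatFunc.C c)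
    -- I is a nonempty open interval in ℝ
    (I : Set ℝ) (a b : ℝ) (hab : a < b) (hI : I = Set.Ioo a b)
    -- all p_k and r_k are defined on I: no denominator vanishes there
    (hdef : ∀ k : Fin m, ∀ x ∈ I,
      Polynomial.eval (x : ℂ) (p k).denom ≠ 0 ∧ Polynomial.eval (x : ℂ) (r k).denom ≠ 0)
    (hzero : ∀ x ∈ I,
      ∑ k : Fin m, RatFunc.eval (RingHom.id ℂ) (x : ℂ) (p k) *
        Complex.exp (RatFunc.eval (RingHom.id ℂ) (x : ℂ) (r k)) = 0) :
    ∀ k : Fin m, p k = 0 := by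
  subst hI
  obtain ⟨U, V, hV0, hV, hrU, hrx⟩ := aux_common r _ fun k x hx => (hdef k x hx).2
  obtain ⟨P, W, hW0, hW, hpP, hpx⟩ := aux_common p _ fun k x hx => (hdef k x hx).1
  have := aux_main U V a b hab hV (fun i j hij c hc => by
    refine hnc i j hij c ?_
    rw [hrU i, hrU j, ← sub_div, ← map_sub, hc, map_mul, mul_div_assoc, div_self
      (RatFunc.algebraMap_ne_zero hV0), mul_one, RatFunc.algebraMap_C]) Finset.univ P
    (fun x hx => by
      have h1 := hzero x hx
      have h2 : ∑ k, (P k).eval (x : ℂ) * Complex.exp ((U k).eval (x : ℂ) / V.eval (x : ℂ))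
          = W.eval (x : ℂ) * ∑ k : Fin m, RatFunc.eval (RingHom.id ℂ) (x : ℂ) (p k) *
            Complex.exp (RatFunc.eval (RingHom.id ℂ) (x : ℂ) (r k)) := by
        rw [Finset.mul_sum]
        refine Finset.sum_congr rfl fun k _ => ?_
        rw [hpx k x hx, hrx k x hx]
        have := hW x hx
        field_simp
      rw [h2, h1, mul_zero])
  intro k
  rw [hpP k, this k (Finset.mem_univ k), map_zero, zero_div]
end

section
/- Let n ≥ 2 and d ∈ ℤ. Let P₁ and P₂ be polynomials in n variables with complex coefficients, with P₂ not the zero polynomial, such that the rational function P(x) = P₁(x)/P₂(x) is homogeneous of degree d, i.e. P(λx) = λ^d · P(x) for all λ ∈ ℝ ∖ {0} and all x ∈ ℝⁿ with P₂(x) ≠ 0 and P₂(λx) ≠ 0. Let S be a significant subset of ℝⁿ with P₂(x) ≠ 0 for all x ∈ S. If P(x) = 0 for every x ∈ S, then P₁ is the zero polynomial. -/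
/-- with `n = q + 1 ≥ 2`. A rational function `P = P₁/P₂` in `n` variables
over `ℂ` that is homogeneous of degree `d ∈ ℤ` and vanishes on a significant subset `S` of
`ℝⁿ` has zero numerator, i.e. `P₁ = 0`. A set `S` is significant if `x₁ ≠ 0` on `S` and the
set `Ŝ = {(x₂/x₁, …, xₙ/x₁) : x ∈ S}` contains a nonempty open subset of `ℝ^{n-1}`. -/
theorem homogeneous_rational_function_zero_on_significant_set
    (q : ℕ) (hq : 1 ≤ q) (d : ℤ)
    (P₁ P₂ : MvPolynomial (Fin (q + 1)) ℂ) (hP₂ : P₂ ≠ 0)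
    -- P = P₁/P₂ is homogeneous of degree d
    (hhom : ∀ l : ℝ, l ≠ 0 → ∀ x : Fin (q + 1) → ℝ,
      MvPolynomial.eval (fun i => (x i : ℂ)) P₂ ≠ 0 →
      MvPolynomial.eval (fun i => ((l * x i : ℝ) : ℂ)) P₂ ≠ 0 →
      MvPolynomial.eval (fun i => ((l * x i : ℝ) : ℂ)) P₁ /
          MvPolynomial.eval (fun i => ((l * x i : ℝ) : ℂ)) P₂ =
        (l : ℂ) ^ d *
          (MvPolynomial.eval (fun i => (x i : ℂ)) P₁ /
            MvPolynomial.eval (fun i => (x i : ℂ)) P₂))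
    (S : Set (Fin (q + 1) → ℝ))
    -- S is a significant set
    (hS1 : ∀ x ∈ S, x 0 ≠ 0)
    (hS2 : ∃ U : Set (Fin q → ℝ), IsOpen U ∧ U.Nonempty ∧
      U ⊆ (fun x : Fin (q + 1) → ℝ => fun i : Fin q => x i.succ / x 0) '' S)
    -- P₂ does not vanish on S
    (hden : ∀ x ∈ S, MvPolynomial.eval (fun i => (x i : ℂ)) P₂ ≠ 0)
    -- P vanishes on S
    (hzero : ∀ x ∈ S,
      MvPolynomial.eval (fun i => (x i : ℂ)) P₁ /
        MvPolynomial.eval (fun i => (x i : ℂ)) P₂ = 0) :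
    P₁ = 0 := by
  obtain ⟨U, hUo, ⟨u, hu⟩, hUS⟩ := hS2
  have key : ∀ y : Fin (q + 1) → ℝ, y 0 ≠ 0 → (fun i : Fin q => y i.succ / y 0) ∈ U →
      MvPolynomial.eval (fun i => (y i : ℂ)) (P₁ * P₂) = 0 := by
    intro y hy0 hyU
    obtain ⟨x, hxS, hx⟩ := hUS hyU
    have hx0 := hS1 x hxS
    have hxy : ∀ i, y i = y 0 / x 0 * x i := by
      intro i
      refine Fin.cases ?_ (fun j => ?_) i
      · field_simp
      · have := congrFun hx j
        simp only at this
        field_simp at this ⊢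
        linarith
    rw [map_mul]
    by_cases h2 : MvPolynomial.eval (fun i => (y i : ℂ)) P₂ = 0
    · rw [h2, mul_zero]
    have hfun : (fun i => ((y 0 / x 0 * x i : ℝ) : ℂ)) = fun i => (y i : ℂ) := by
      funext i; rw [← hxy i]
    have h := hhom (y 0 / x 0) (div_ne_zero hy0 hx0) x (hden x hxS) (by rw [hfun]; exact h2)
    rw [hfun, hzero x hxS, mul_zero, div_eq_zero_iff] at h
    rw [h.resolve_right h2, zero_mul]
  set v : Fin (q + 1) → ℝ := Fin.cons 1 u with hv
  have hv0 : v 0 = 1 := by simp [hv]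
  have hvs : ∀ i : Fin q, v i.succ = u i := by simp [hv]
  have hc : ContinuousAt (fun y : Fin (q + 1) → ℝ => fun i : Fin q => y i.succ / y 0) v := by
    refine continuousAt_pi.2 fun i => ?_
    exact (continuous_apply _).continuousAt.div (continuous_apply _).continuousAt (by simp [hv0])
  have h1 : ∀ᶠ y in nhds v, (fun i : Fin q => y i.succ / y 0) ∈ U := by
    refine hc.eventually (hUo.mem_nhds ?_)
    simpa [hv0, hvs] using hu
  have h2 : ∀ᶠ y in nhds v, y 0 ≠ 0 :=
    (continuous_apply (0 : Fin (q + 1))).continuousAt.eventually_ne (by simp [hv0])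
  obtain ⟨ε, hε, hb⟩ := Metric.eventually_nhds_iff_ball.1 (h1.and h2)
  have hQ : P₁ * P₂ = 0 := by
    refine MvPolynomial.funext_set
      (fun i => (fun r : ℝ => (r : ℂ)) '' Metric.ball (v i) ε) (fun i => ?_) fun z hz => ?_
    · refine Set.Infinite.image Complex.ofReal_injective.injOn ?_
      rw [Real.ball_eq_Ioo]
      exact Set.Ioo_infinite (by linarith)
    · choose y hy hyz using fun i => hz i (Set.mem_univ i)
      have hz' : z = fun i => (y i : ℂ) := funext fun i => (hyz i).symm
      have hyb : y ∈ Metric.ball v ε := by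
        rw [ball_pi _ hε]
        exact fun i _ => hy i
      rw [hz', map_zero]
      exact key y (hb y hyb).2 (hb y hyb).1
  exact (mul_eq_zero.1 hQ).resolve_right hP₂
end
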